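/- For each p equal to 0 or a prime number, and for every nonzero arithmetic degree D, the theory ACF_p of algebraically closed fields of characteristic p, in the language of rings, is D-categorical. -/

import Mathlib

open FirstOrder FirstOrder.Language

namespace ArMorley

/-! ## Arithmetical sets and arithmetic reducibility -/

/-- Function symbols of the language of arithmetic: `0`, `1`, `+`, `·`. -/
inductive ArFunc : ℕ → Type
  | zero : ArFunc 0
  | one : ArFunc 0
  | add : ArFunc 2
  | mul : ArFunc 2

/-- Relation symbols: `<` and a unary oracle predicate. -/
inductive ArRel : ℕ → Type
  | lt : ArRel 2
  | mem : ArRel 1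

/-- The language `(+, ·, 0, 1, <, Y)` of arithmetic with a unary oracle predicate. -/
def arithLang : FirstOrder.Language := ⟨ArFunc, ArRel⟩

/-- The standard structure on `ℕ`, with the oracle predicate interpreted by `Y`. -/
def arithStructure (Y : Set ℕ) : arithLang.Structure ℕ where
  funMap := fun {n} f =>
    match f with
    | ArFunc.zero => fun _ => 0
    | ArFunc.one => fun _ => 1
    | ArFunc.add => fun v => v 0 + v 1
    | ArFunc.mul => fun v => v 0 * v 1
  RelMap := fun {n} r =>
    match r with
    | ArRel.lt => fun v => v 0 < v 1
    | ArRel.mem => fun v => v 0 ∈ Y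

/-- `X ≤_ar Y` : `X` is definable without parameters in `(ℕ, +, ·, 0, 1, <, Y)`. -/
def ArReducible (X Y : Set ℕ) : Prop :=
  letI := arithStructure Y
  ∃ φ : arithLang.Formula (Fin 1), X = { n : ℕ | φ.Realize (fun _ => n) }

/-- `X` is arithmetical: definable without parameters in `(ℕ, +, ·, 0, 1, <)`. -/
def IsArithmetical (X : Set ℕ) : Prop := ArReducible X ∅

/-- `X` and `Y` have the same arithmetic degree. -/
def ArEquiv (X Y : Set ℕ) : Prop := ArReducible X Y ∧ ArReducible Y X

/-! ## Coding conventions -/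

/-- Code of a list of naturals. -/
def listCode (l : List ℕ) : ℕ := Encodable.encode l

/-- Code of a finite tuple of naturals. -/
def tupleCode {n : ℕ} (v : Fin n → ℕ) : ℕ := listCode (List.ofFn v)

/-- The subset of `ℕ` corresponding to a set of elements of a coded domain. -/
def subCode {A : Set ℕ} (S : Set ↥A) : Set ℕ := Subtype.val '' S

/-- Code of a set of `n`-tuples from a coded domain as a subset of `ℕ`. -/
def tupleSetCode {A : Set ℕ} {n : ℕ} (X : Set (Fin n → ↥A)) : Set ℕ :=
  { c : ℕ | ∃ v ∈ X, c = tupleCode (fun i => ((v i : ℕ))) }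

/-- Code of the graph of a function between coded domains. -/
def graphCode {A B : Set ℕ} (f : ↥A → ↥B) : Set ℕ :=
  { c : ℕ | ∃ a : ↥A, c = Nat.pair (a : ℕ) ((f a : ℕ)) }

/-! ## Gödel coded languages -/

/-- A fixed Gödel coding of the symbols of a countable first-order language. -/
structure GoedelCoding (L : FirstOrder.Language) where
  encFun : ∀ n, L.Functions n → ℕ
  encFun_inj : ∀ n, Function.Injective (encFun n)
  encRel : ∀ n, L.Relations n → ℕ
  encRel_inj : ∀ n, Function.Injective (encRel n)

variable {L : FirstOrder.Language}

/-- The set of codes of the symbols of `L`. -/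
def symbolCodes (g : GoedelCoding L) : Set ℕ :=
  { c | (∃ (n : ℕ) (f : L.Functions n), c = Nat.pair 0 (Nat.pair n (g.encFun n f))) ∨
        (∃ (n : ℕ) (R : L.Relations n), c = Nat.pair 1 (Nat.pair n (g.encRel n R))) }

/-- `L` is an arithmetically definable language. -/
def ArithLang (g : GoedelCoding L) : Prop := IsArithmetical (symbolCodes g)

/-- Code of a term, with a given coding of the variables. -/
def termCode (g : GoedelCoding L) {α : Type} (encα : α → ℕ) (t : L.Term α) : ℕ :=
  listCode (t.listEncode.map (Sum.elim (fun a => Nat.pair 0 (encα a))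
    (fun p => Nat.pair 1 (Nat.pair p.1 (g.encFun p.1 p.2)))))

/-- Code of a (bounded) formula, with a given coding of free variables. -/
def formulaCode (g : GoedelCoding L) {α : Type} (encα : α → ℕ) {n : ℕ}
    (φ : L.BoundedFormula α n) : ℕ :=
  listCode (φ.listEncode.map (Sum.elim
    (fun p => Nat.pair 0 (Nat.pair p.1
      (termCode g (Sum.elim (fun a => Nat.pair 0 (encα a)) (fun i => Nat.pair 1 i.1)) p.2)))
    (Sum.elim
      (fun q => Nat.pair 1 (Nat.pair q.1 (g.encRel q.1 q.2)))
      (fun m => Nat.pair 2 m))))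

/-- Code of a sentence. -/
def sentenceCode (g : GoedelCoding L) (φ : L.Sentence) : ℕ :=
  formulaCode g (fun a : Empty => a.elim) φ

/-- The set of codes of the axioms of a theory. -/
def theoryCode (g : GoedelCoding L) (T : L.Theory) : Set ℕ :=
  { c | ∃ φ ∈ T, c = sentenceCode g φ }

/-- `T` is an arithmetically definable theory. -/
def ArithTheory (g : GoedelCoding L) (T : L.Theory) : Prop := IsArithmetical (theoryCode g T)

/-! ## Coded structures -/

/-- A coded `L`-structure: an `L`-structure whose domain is a subset of `ℕ`
with infinite complement. -/
structure CodedStructure (L : FirstOrder.Language) where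
  carrier : Set ℕ
  compl_infinite : (carrierᶜ : Set ℕ).Infinite
  struc : L.Structure ↥carrier

/-- A coded structure is a model of `T`. -/
def CodedStructure.Models (M : CodedStructure L) (T : L.Theory) : Prop :=
  ∀ φ ∈ T, @Sentence.Realize L ↥M.carrier M.struc φ

/-- The (coded) elementary diagram of a coded structure. -/
def elemDiagram (g : GoedelCoding L) (M : CodedStructure L) : Set ℕ :=
  { c | ∃ (k : ℕ) (φ : L.Formula (Fin k)) (a : Fin k → ↥M.carrier),
      c = Nat.pair (Nat.pair k (formulaCode g Fin.val φ)) (tupleCode fun i => ((a i : ℕ))) ∧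
      (letI := M.struc; φ.Realize a) }

/-- A coded structure is arithmetically decidable if its elementary diagram is arithmetical. -/
def ArithDecidable (g : GoedelCoding L) (M : CodedStructure L) : Prop :=
  IsArithmetical (elemDiagram g M)

/-- `M ≼ N` for coded structures: `M`'s domain is contained in `N`'s, and the
inclusion is elementary. -/
structure ElemSub (M N : CodedStructure L) : Prop where
  subset : M.carrier ⊆ N.carrier
  elem : ∀ (k : ℕ) (φ : L.Formula (Fin k)) (a : Fin k → ↥M.carrier),
    (letI := M.struc; φ.Realize a) ↔
      (letI := N.struc; φ.Realize (fun i => (⟨((a i : ℕ)), subset (a i).2⟩ : ↥N.carrier)))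

/-- A coded model of `T` is arithmetically extendible if it is an elementary substructure of
an arithmetically decidable coded model of `T`. -/
def ArithExtendible (g : GoedelCoding L) (T : L.Theory) (M : CodedStructure L) : Prop :=
  ∃ N : CodedStructure L, ArithDecidable g N ∧ N.Models T ∧ ElemSub M N

/-! ## Model-theoretic notions in arbitrary structures -/

/-- `N` (with structure `SN`) is a model of `T`. -/
def ModelsT (L : FirstOrder.Language) (T : L.Theory) (N : Type) (SN : L.Structure N) : Prop :=
  ∀ φ ∈ T, @Sentence.Realize L N SN φ

/-- `T` has no finite models. -/
def NoFiniteModels (L : FirstOrder.Language) (T : L.Theory) : Prop :=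
  ∀ (N : Type) (SN : L.Structure N), ModelsT L T N SN → Infinite N

/-- Elementary embeddings, with the structures given explicitly. -/
def EEmb (L : FirstOrder.Language) (M : Type) (SM : L.Structure M)
    (N : Type) (SN : L.Structure N) : Type _ :=
  @FirstOrder.Language.ElementaryEmbedding L M N SM SN

/-- The underlying map of an elementary embedding. -/
def EEmb.fn {L : FirstOrder.Language} {M : Type} {SM : L.Structure M}
    {N : Type} {SN : L.Structure N} (j : EEmb L M SM N SN) : M → N :=
  @FirstOrder.Language.ElementaryEmbedding.toFun L M N SM SN j

/-- A subset of `N^n` definable with parameters from `P`. -/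
def DefinableOverT (L : FirstOrder.Language) (N : Type) (SN : L.Structure N) (P : Set N)
    {n : ℕ} (X : Set (Fin n → N)) : Prop :=
  letI := SN
  ∃ (m : ℕ) (ψ : L.Formula (Fin n ⊕ Fin m)) (b : Fin m → N),
    (∀ i, b i ∈ P) ∧ X = { v | ψ.Realize (Sum.elim v b) }

/-- A subset of `N` definable with (arbitrary) parameters. -/
def Definable1 (L : FirstOrder.Language) (N : Type) (SN : L.Structure N) (Y : Set N) : Prop :=
  letI := SN
  ∃ (m : ℕ) (ψ : L.Formula (Fin 1 ⊕ Fin m)) (b : Fin m → N),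
    Y = { x : N | ψ.Realize (Sum.elim (fun _ => x) b) }

/-- The algebraic closure of `B` in `N`: elements satisfying a formula with parameters
from `B` having finitely many solutions. -/
def aclIn (L : FirstOrder.Language) (N : Type) (SN : L.Structure N) (B : Set N) : Set N :=
  letI := SN
  { a : N | ∃ (k : ℕ) (φ : L.Formula (Fin 1 ⊕ Fin k)) (b : Fin k → N),
      (∀ i, b i ∈ B) ∧ φ.Realize (Sum.elim (fun _ => a) b) ∧
      { x : N | φ.Realize (Sum.elim (fun _ => x) b) }.Finite }

/-- The domain of the substructure of `N` generated by `B`: values of terms at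
arguments from `B`. -/
def genSub (L : FirstOrder.Language) (N : Type) (SN : L.Structure N) (B : Set N) : Set N :=
  letI := SN
  { a : N | ∃ (t : L.Term ℕ) (v : ℕ → N), (∀ i, v i ∈ B) ∧ a = t.realize v }

/-- The set defined by a formula `φ(x, p̄)` in one free variable with parameters `p̄`. -/
def smSet (L : FirstOrder.Language) (N : Type) (SN : L.Structure N) {k : ℕ}
    (φ : L.Formula (Fin 1 ⊕ Fin k)) (p : Fin k → N) : Set N :=
  letI := SN
  { x : N | φ.Realize (Sum.elim (fun _ => x) p) }

/-- A definable tuple-set in a coded structure, with parameters from `P`. -/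
def DefinableOver (M : CodedStructure L) (P : Set ↥M.carrier) {n : ℕ}
    (X : Set (Fin n → ↥M.carrier)) : Prop :=
  DefinableOverT L ↥M.carrier M.struc P X

/-- A definable tuple-set in a coded structure, with arbitrary parameters. -/
def DefinableIn (M : CodedStructure L) {n : ℕ} (X : Set (Fin n → ↥M.carrier)) : Prop :=
  DefinableOver M Set.univ X

/-! ## Isomorphisms of coded structures and `D`-categoricity -/

/-- An isomorphism of coded `L`-structures. -/
structure CodedIso (M N : CodedStructure L) where
  toFun : ↥M.carrier → ↥N.carrier
  invFun : ↥N.carrier → ↥M.carrier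
  left_inv : Function.LeftInverse invFun toFun
  right_inv : Function.RightInverse invFun toFun
  map_fun : ∀ {k : ℕ} (f : L.Functions k) (v : Fin k → ↥M.carrier),
    toFun (M.struc.funMap f v) = N.struc.funMap f (toFun ∘ v)
  map_rel : ∀ {k : ℕ} (r : L.Relations k) (v : Fin k → ↥M.carrier),
    M.struc.RelMap r v ↔ N.struc.RelMap r (toFun ∘ v)

/-- `f` is a `D`-preserving isomorphism, where `d` is a representative of the
arithmetic degree `D`. -/
def DPreserving (d : Set ℕ) {M N : CodedStructure L} (f : CodedIso M N) : Prop :=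
  ArReducible (graphCode f.toFun) d ∧
  ArReducible (graphCode f.invFun) d ∧
  (∀ (n : ℕ) (X : Set (Fin n → ↥M.carrier)), DefinableIn M X →
      ArEquiv (tupleSetCode X) d →
      ArEquiv (tupleSetCode ((fun v => f.toFun ∘ v) '' X)) d) ∧
  (∀ (n : ℕ) (Y : Set (Fin n → ↥N.carrier)), DefinableIn N Y →
      ArEquiv (tupleSetCode Y) d →
      ArEquiv (tupleSetCode ((fun v => f.invFun ∘ v) '' Y)) d)

/-- `T` is `D`-categorical, where `d` is a representative of the nonzero
arithmetic degree `D`. -/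
def DCategorical (g : GoedelCoding L) (T : L.Theory) (d : Set ℕ) : Prop :=
  ∀ M₀ M₁ M₂ : CodedStructure L,
    ArithDecidable g M₀ → M₀.Models T →
    M₁.Models T → ArithExtendible g T M₁ →
    M₂.Models T → ArithExtendible g T M₂ →
    ElemSub M₀ M₁ → ElemSub M₀ M₂ →
    ArEquiv M₁.carrier d → ArEquiv M₂.carrier d →
    ∃ f : CodedIso M₁ M₂, DPreserving d f ∧
      ∀ (x : ℕ) (hx : x ∈ M₀.carrier) (h₁ : x ∈ M₁.carrier),
        ((f.toFun ⟨x, h₁⟩ : ℕ)) = x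

/-! ## Vaughtian pairs, prime models, strong minimality -/

/-- `T` has a Vaughtian pair. -/
def HasVaughtianPair (T : L.Theory) : Prop :=
  ∃ (N : Type) (SN : L.Structure N),
    ModelsT L T N SN ∧
    ∃ S : @FirstOrder.Language.ElementarySubstructure L N SN,
      ((S.toSubstructure : Set N) ≠ Set.univ ∧
      ∃ (k : ℕ) (φ : L.Formula (Fin 1 ⊕ Fin k)) (a : Fin k → N),
        (∀ i, a i ∈ (S.toSubstructure : Set N)) ∧
        smSet L N SN φ a ⊆ (S.toSubstructure : Set N) ∧
        (smSet L N SN φ a).Infinite)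

/-- A coded model of `T` is prime: it elementarily embeds into every model of `T`. -/
def PrimeModel (L : FirstOrder.Language) (T : L.Theory) (P : CodedStructure L) : Prop :=
  P.Models T ∧ ∀ (N : Type) (SN : L.Structure N), ModelsT L T N SN →
    Nonempty (EEmb L ↥P.carrier P.struc N SN)

/-- `φ(x, p̄)` is strongly minimal over the coded model `M`: its solution set in `M` is
infinite, and in every elementary extension of `M` modelling `T` every definable subset of
its solution set is finite or cofinite in it. -/
def StronglyMinimalOver (T : L.Theory) (M : CodedStructure L) {k : ℕ}
    (φ : L.Formula (Fin 1 ⊕ Fin k)) (p : Fin k → ↥M.carrier) : Prop :=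
  (smSet L ↥M.carrier M.struc φ p).Infinite ∧
  ∀ (N : Type) (SN : L.Structure N), ModelsT L T N SN →
    ∀ j : EEmb L ↥M.carrier M.struc N SN,
      ∀ Y : Set N, Definable1 L N SN Y →
        Y ⊆ smSet L N SN φ (fun i => j.fn (p i)) →
        (Y.Finite ∨ ((smSet L N SN φ (fun i => j.fn (p i))) \ Y).Finite)

/-- `T` is a strongly minimal theory: every model is infinite, and every
parameter-definable subset of any model is finite or cofinite. -/
def StronglyMinimalTheory (L : FirstOrder.Language) (T : L.Theory) : Prop :=
  (∀ (N : Type) (SN : L.Structure N), ModelsT L T N SN → Infinite N) ∧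
  (∀ (N : Type) (SN : L.Structure N), ModelsT L T N SN →
    ∀ Y : Set N, Definable1 L N SN Y → (Y.Finite ∨ (Yᶜ : Set N).Finite))

/-- The structural control clause: an arithmetically decidable prime model together with
a strongly minimal formula over it generating every elementary extension. -/
def GeneratesAll (T : L.Theory) (P : CodedStructure L) {k : ℕ}
    (φ : L.Formula (Fin 1 ⊕ Fin k)) (p : Fin k → ↥P.carrier) : Prop :=
  ∀ (N : Type) (SN : L.Structure N), ModelsT L T N SN →
    ∀ j : EEmb L ↥P.carrier P.struc N SN,
      aclIn L N SN (Set.range j.fn ∪ smSet L N SN φ (fun i => j.fn (p i))) = Set.univ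

/-- Clause (3) of the arithmetic Baldwin–Lachlan theorem. -/
def SMControl (g : GoedelCoding L) (T : L.Theory) : Prop :=
  ∃ (P : CodedStructure L), ArithDecidable g P ∧ PrimeModel L T P ∧
    ∃ (k : ℕ) (φ : L.Formula (Fin 1 ⊕ Fin k)) (p : Fin k → ↥P.carrier),
      StronglyMinimalOver T P φ p ∧ GeneratesAll T P φ p

/-! ## Types and arithmetical stability -/

/-- A formula with a finite parameter tuple from a coded structure, in `n` object
variables. -/
def ParamFormula (L : FirstOrder.Language) (M : CodedStructure L) (n : ℕ) : Type :=
  Σ k : ℕ, L.Formula (Fin n ⊕ Fin k) × (Fin k → ↥M.carrier)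

/-- All parameters of `q` lie in `A`. -/
def paramsIn {M : CodedStructure L} {n : ℕ} (A : Set ℕ) (q : ParamFormula L M n) : Prop :=
  ∀ i, ((q.2.2 i : ℕ)) ∈ A

/-- `p` is consistent with the elementary diagram of `M`: it is realized in some
elementary extension of `M`. -/
def TypeConsistent (M : CodedStructure L) {n : ℕ} (p : Set (ParamFormula L M n)) : Prop :=
  ∃ (N : Type) (SN : L.Structure N) (j : EEmb L ↥M.carrier M.struc N SN) (b : Fin n → N),
    ∀ q ∈ p, letI := SN; q.2.1.Realize (Sum.elim b (fun i => j.fn (q.2.2 i)))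

/-- `p` is a (complete) `n`-type over `A` inside `M`: a maximal set of formulas with
parameters from `A` consistent with the elementary diagram of `M`. -/
def IsNType (M : CodedStructure L) (A : Set ℕ) (n : ℕ)
    (p : Set (ParamFormula L M n)) : Prop :=
  (∀ q ∈ p, paramsIn A q) ∧
  TypeConsistent M p ∧
  ∀ q : ParamFormula L M n, paramsIn A q → q ∉ p → ¬ TypeConsistent M (insert q p)

/-- The code of a formula-with-parameters. -/
def pfCode (g : GoedelCoding L) {M : CodedStructure L} {n : ℕ} (q : ParamFormula L M n) : ℕ :=
  Nat.pair
    (Nat.pair q.1 (formulaCode g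
      (Sum.elim (fun i : Fin n => Nat.pair 0 i.1) (fun j : Fin q.1 => Nat.pair 1 j.1)) q.2.1))
    (tupleCode fun i => ((q.2.2 i : ℕ)))

/-- The set of codes of the formulas of `p`. -/
def typeCode (g : GoedelCoding L) {M : CodedStructure L} {n : ℕ}
    (p : Set (ParamFormula L M n)) : Set ℕ :=
  { c | ∃ q ∈ p, c = pfCode g q }

/-- `p` is realized in the coded elementary extension `N` of `M`. -/
def RealizesType {M N : CodedStructure L} (h : M.carrier ⊆ N.carrier) {n : ℕ}
    (p : Set (ParamFormula L M n)) : Prop :=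
  ∃ b : Fin n → ↥N.carrier, ∀ q ∈ p,
    letI := N.struc
    q.2.1.Realize (Sum.elim b (fun i => (⟨((q.2.2 i : ℕ)), h (q.2.2 i).2⟩ : ↥N.carrier)))

/-- The `(n, i)`-th column of an effective join. -/
def tripleSection (X : Set ℕ) (n i : ℕ) : Set ℕ := { m | Nat.pair n (Nat.pair i m) ∈ X }

/-- `T` is arithmetically stable: over every arithmetically decidable model and every
arithmetical parameter set, the family of arithmetic `n`-types (for all `n ≥ 1`) has a
uniform arithmetical code in which every arithmetic `n`-type appears at least once. -/
def ArithStable (g : GoedelCoding L) (T : L.Theory) : Prop :=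
  ∀ M : CodedStructure L, ArithDecidable g M → M.Models T →
    ∀ A : Set ℕ, A ⊆ M.carrier → IsArithmetical A →
      ∃ X : Set ℕ, IsArithmetical X ∧
        (∀ n, 1 ≤ n → ∀ i : ℕ, ∃ p : Set (ParamFormula L M n),
            IsNType M A n p ∧ IsArithmetical (typeCode g p) ∧
            tripleSection X n i = typeCode g p) ∧
        (∀ n, 1 ≤ n → ∀ p : Set (ParamFormula L M n),
            IsNType M A n p → IsArithmetical (typeCode g p) →
            ∃ i : ℕ, tripleSection X n i = typeCode g p)

/-- The set of elements occurring as a coordinate of a tuple in `X`. -/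
def coordSet {N : Type} {n : ℕ} (X : Set (Fin n → N)) : Set N :=
  { m | ∃ v ∈ X, ∃ i, v i = m }

/-! ## Relations on assignments definable in arithmetic -/

/-- A function of an assignment of natural numbers to variables given by a term. -/
def IsTermFun (Y : Set ℕ) (t : (ℕ → ℕ) → ℕ) : Prop :=
  letI := arithStructure Y
  ∃ τ : arithLang.Term ℕ, ∀ v, τ.realize v = t v

/-- A property of assignments of natural numbers to variables given by a formula. -/
def IsVarDef (Y : Set ℕ) (p : (ℕ → ℕ) → Prop) : Prop :=
  letI := arithStructure Y
  ∃ φ : arithLang.Formula ℕ, ∀ v, φ.Realize v ↔ p v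

section VarDef

variable {Y : Set ℕ} {p q : (ℕ → ℕ) → Prop} {s t : (ℕ → ℕ) → ℕ}

theorem IsTermFun.var (i : ℕ) : IsTermFun Y (fun v => v i) :=
  ⟨Term.var i, fun _ => rfl⟩

theorem IsTermFun.add (hs : IsTermFun Y s) (ht : IsTermFun Y t) :
    IsTermFun Y (fun v => s v + t v) := by
  obtain ⟨σ, hσ⟩ := hs
  obtain ⟨τ, hτ⟩ := ht
  refine ⟨Term.func (L := arithLang) (ArFunc.add : arithLang.Functions 2) ![σ, τ],
    fun v => congrArg₂ (· + ·) (hσ v) (hτ v)⟩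

theorem IsTermFun.mul (hs : IsTermFun Y s) (ht : IsTermFun Y t) :
    IsTermFun Y (fun v => s v * t v) := by
  obtain ⟨σ, hσ⟩ := hs
  obtain ⟨τ, hτ⟩ := ht
  refine ⟨Term.func (L := arithLang) (ArFunc.mul : arithLang.Functions 2) ![σ, τ],
    fun v => congrArg₂ (· * ·) (hσ v) (hτ v)⟩

theorem IsTermFun.const (c : ℕ) : IsTermFun Y (fun _ => c) := by
  induction c with
  | zero => exact ⟨Term.func (L := arithLang) (ArFunc.zero : arithLang.Functions 0) ![],
      fun _ => rfl⟩
  | succ c ih =>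
    exact ih.add ⟨Term.func (L := arithLang) (ArFunc.one : arithLang.Functions 0) ![],
      fun _ => rfl⟩

theorem IsVarDef.congr (hp : IsVarDef Y p) (h : ∀ v, p v ↔ q v) : IsVarDef Y q := by
  obtain ⟨φ, hφ⟩ := hp
  exact ⟨φ, fun v => (hφ v).trans (h v)⟩

theorem IsTermFun.eq (hs : IsTermFun Y s) (ht : IsTermFun Y t) :
    IsVarDef Y (fun v => s v = t v) := by
  let := arithStructure Y
  obtain ⟨σ, hσ⟩ := hs
  obtain ⟨τ, hτ⟩ := ht
  exact ⟨σ.equal τ, fun v => by rw [Formula.realize_equal, hσ, hτ]⟩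

theorem IsTermFun.lt (hs : IsTermFun Y s) (ht : IsTermFun Y t) :
    IsVarDef Y (fun v => s v < t v) := by
  let := arithStructure Y
  obtain ⟨σ, hσ⟩ := hs
  obtain ⟨τ, hτ⟩ := ht
  refine ⟨Relations.formula₂ (L := arithLang) (ArRel.lt : arithLang.Relations 2) σ τ,
    fun v => Formula.realize_rel₂.trans (iff_of_eq (congrArg₂ (· < ·) (hσ v) (hτ v)))⟩

theorem IsTermFun.mem (hs : IsTermFun Y s) : IsVarDef Y (fun v => s v ∈ Y) := by
  let := arithStructure Y
  obtain ⟨σ, hσ⟩ := hs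
  refine ⟨Relations.formula₁ (L := arithLang) (ArRel.mem : arithLang.Relations 1) σ,
    fun v => Formula.realize_rel₁.trans (iff_of_eq (congrArg (· ∈ Y) (hσ v)))⟩

theorem IsVarDef.not (hp : IsVarDef Y p) : IsVarDef Y (fun v => ¬ p v) := by
  let := arithStructure Y
  obtain ⟨φ, hφ⟩ := hp
  exact ⟨φ.not, fun v => by rw [Formula.realize_not, hφ]⟩

theorem IsVarDef.and (hp : IsVarDef Y p) (hq : IsVarDef Y q) :
    IsVarDef Y (fun v => p v ∧ q v) := by
  let := arithStructure Y
  obtain ⟨φ, hφ⟩ := hp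
  obtain ⟨ψ, hψ⟩ := hq
  exact ⟨φ ⊓ ψ, fun v => by rw [Formula.realize_inf, hφ, hψ]⟩

theorem IsVarDef.or (hp : IsVarDef Y p) (hq : IsVarDef Y q) :
    IsVarDef Y (fun v => p v ∨ q v) := by
  let := arithStructure Y
  obtain ⟨φ, hφ⟩ := hp
  obtain ⟨ψ, hψ⟩ := hq
  exact ⟨φ ⊔ ψ, fun v => by rw [Formula.realize_sup, hφ, hψ]⟩

theorem IsVarDef.rename (hp : IsVarDef Y p) (f : ℕ → ℕ) : IsVarDef Y (fun v => p (v ∘ f)) := by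
  let := arithStructure Y
  obtain ⟨φ, hφ⟩ := hp
  exact ⟨φ.relabel f, fun v => by rw [Formula.realize_relabel, hφ]⟩

theorem IsVarDef.exists (i : ℕ) (hp : IsVarDef Y p) :
    IsVarDef Y (fun v => ∃ x, p (Function.update v i x)) := by
  let := arithStructure Y
  obtain ⟨φ, hφ⟩ := hp
  refine ⟨(BoundedFormula.relabel (n := 1)
    (fun j : ℕ => if j = i then Sum.inr 0 else Sum.inl j) φ).ex, fun v => ?_⟩
  rw [Formula.Realize, BoundedFormula.realize_ex]
  refine exists_congr fun x => ?_
  rw [BoundedFormula.realize_relabel, ← hφ, Formula.Realize]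
  have h : (Sum.elim v (Fin.snoc (default : Fin 0 → ℕ) x ∘ Fin.castAdd 0) ∘
      fun j : ℕ => if j = i then (Sum.inr 0 : ℕ ⊕ Fin 1) else Sum.inl j) =
      Function.update v i x := by
    funext j
    by_cases hj : j = i
    · subst hj
      simp [Fin.snoc]
    · simp [hj]
  exact iff_of_eq (congrArg₂ _ h (Subsingleton.elim _ _))

theorem isVarDef_pair (i j k : ℕ) : IsVarDef Y (fun v => Nat.pair (v i) (v j) = v k) := by
  have hi := IsTermFun.var (Y := Y) i
  have hj := IsTermFun.var (Y := Y) j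
  have hk := IsTermFun.var (Y := Y) k
  refine (((hi.lt hj).and (((hj.mul hj).add hi).eq hk)).or
    ((hi.lt hj).not.and ((((hi.mul hi).add hi).add hj).eq hk))).congr fun v => ?_
  rw [Nat.pair]
  split_ifs <;> simp [*]

theorem arReducible_iff_isVarDef {X : Set ℕ} :
    ArReducible X Y ↔ IsVarDef Y (fun v => v 0 ∈ X) := by
  let := arithStructure Y
  constructor
  · rintro ⟨φ, rfl⟩
    refine ⟨φ.relabel fun _ => 0, fun v => ?_⟩
    rw [Formula.realize_relabel]
    rfl
  · rintro ⟨φ, hφ⟩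
    refine ⟨φ.relabel fun _ => 0, ?_⟩
    ext n
    rw [Set.mem_ofPred_eq, Formula.realize_relabel, hφ]
    rfl

theorem ArReducible.isVarDef {X : Set ℕ} (h : ArReducible X Y) (i : ℕ) :
    IsVarDef Y (fun v => v i ∈ X) :=
  (arReducible_iff_isVarDef.1 h).rename fun _ => i

end VarDef

section Trans

variable {X Y Z : Set ℕ}

theorem realize_term_arithStructure {α : Type} (t : arithLang.Term α) (v : α → ℕ) :
    @Term.realize arithLang ℕ (arithStructure Y) α v t =
      @Term.realize arithLang ℕ (arithStructure Z) α v t := by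
  induction t with
  | var _ => rfl
  | func f ts ih =>
    simp only [Term.realize, ih]
    cases f <;> rfl

theorem ArReducible.exists_boundedFormula (h : ArReducible Z Y) {α : Type} {n : ℕ}
    (φ : arithLang.BoundedFormula α n) :
    ∃ ψ : arithLang.BoundedFormula α n, ∀ v xs,
      @BoundedFormula.Realize arithLang ℕ (arithStructure Y) α n ψ v xs ↔
      @BoundedFormula.Realize arithLang ℕ (arithStructure Z) α n φ v xs := by
  induction φ with
  | falsum => exact ⟨.falsum, fun _ _ => Iff.rfl⟩
  | equal t₁ t₂ =>
    refine ⟨.equal t₁ t₂, fun v xs => ?_⟩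
    simp only [BoundedFormula.Realize]
    rw [realize_term_arithStructure (Y := Y) (Z := Z),
      realize_term_arithStructure (Y := Y) (Z := Z)]
  | imp _ _ ih₁ ih₂ =>
    obtain ⟨ψ₁, h₁⟩ := ih₁
    obtain ⟨ψ₂, h₂⟩ := ih₂
    refine ⟨.imp ψ₁ ψ₂, fun v xs => ?_⟩
    simp only [BoundedFormula.Realize, h₁, h₂]
  | all _ ih =>
    obtain ⟨ψ, h⟩ := ih
    refine ⟨.all ψ, fun v xs => ?_⟩
    simp only [BoundedFormula.Realize, h]
  | rel R ts =>
    cases R with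
    | lt =>
      refine ⟨.rel (ArRel.lt : arithLang.Relations 2) ts, fun v xs => ?_⟩
      simp only [BoundedFormula.Realize, realize_term_arithStructure (Y := Y) (Z := Z)]
      rfl
    | mem =>
      obtain ⟨ζ, rfl⟩ := h
      refine ⟨BoundedFormula.relabel id (BoundedFormula.subst ζ fun _ => ts 0), fun v xs => ?_⟩
      let := arithStructure Y
      rw [BoundedFormula.realize_relabel, BoundedFormula.realize_subst]
      refine iff_of_eq (congrArg₂ _ ?_ (Subsingleton.elim _ _))
      funext _
      exact realize_term_arithStructure (ts 0) (Sum.elim v xs)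

theorem ArReducible.trans (hXZ : ArReducible X Z) (h : ArReducible Z Y) : ArReducible X Y := by
  obtain ⟨φ, rfl⟩ := hXZ
  obtain ⟨ψ, hψ⟩ := h.exists_boundedFormula φ
  exact ⟨ψ, Set.ext fun n => (hψ _ _).symm⟩

end Trans

/-! ## Arithmetical predicates and functions on coded types -/

/-- A type whose elements are coded by natural numbers. -/
class Coded (γ : Type) where
  code : γ → ℕ
  code_injective : Function.Injective code

open Coded (code code_injective)

instance : Coded ℕ := ⟨id, Function.injective_id⟩

instance {A : Set ℕ} : Coded ↥A := ⟨Subtype.val, Subtype.val_injective⟩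

instance {α β : Type} [Coded α] [Coded β] : Coded (α × β) where
  code x := Nat.pair (code x.1) (code x.2)
  code_injective x y h := by
    rw [Nat.pair_eq_pair] at h
    exact Prod.ext (code_injective h.1) (code_injective h.2)

/-- The set of codes of the elements satisfying a predicate. -/
def codeSet {γ : Type} [Coded γ] (p : γ → Prop) : Set ℕ := { n | ∃ a, code a = n ∧ p a }

/-- The predicate `p` is arithmetical in `Y`. -/
def ArP (Y : Set ℕ) {γ : Type} [Coded γ] (p : γ → Prop) : Prop := ArReducible (codeSet p) Y

/-- The set of codes of the elements of the type is arithmetical in `Y`. -/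
class ArType (Y : Set ℕ) (γ : Type) [Coded γ] : Prop where
  arP_true : ArP Y fun _ : γ => True

/-- The graph of `f` is arithmetical in `Y`. -/
@[fun_prop]
def ArF (Y : Set ℕ) {α β : Type} [Coded α] [Coded β] (f : α → β) : Prop :=
  ArP Y fun x : α × β => f x.1 = x.2

section

variable {Y Z : Set ℕ} {α β γ δ : Type} [Coded α] [Coded β] [Coded γ] [Coded δ]

theorem mem_codeSet {p : γ → Prop} {n : ℕ} : n ∈ codeSet p ↔ ∃ a, code a = n ∧ p a := Iff.rfl

theorem code_mem_codeSet {p : γ → Prop} {a : γ} : code a ∈ codeSet p ↔ p a := by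
  simp [mem_codeSet, code_injective.eq_iff]

theorem code_prod (x : α × β) : code x = Nat.pair (code x.1) (code x.2) := rfl

theorem mem_codeSet_prod {p : α × β → Prop} {n : ℕ} :
    n ∈ codeSet p ↔ ∃ a b, Nat.pair (code a) (code b) = n ∧ p (a, b) := by
  simp [mem_codeSet, code_prod]

theorem ArP.of_isVarDef {p : γ → Prop} {q : (ℕ → ℕ) → Prop} (hq : IsVarDef Y q)
    (h : ∀ v, q v ↔ v 0 ∈ codeSet p) : ArP Y p :=
  arReducible_iff_isVarDef.2 (hq.congr h)

theorem ArP.isVarDef {p : γ → Prop} (hp : ArP Y p) (i : ℕ) :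
    IsVarDef Y fun v => v i ∈ codeSet p :=
  ArReducible.isVarDef hp i

theorem isVarDef_range (γ : Type) [Coded γ] [ArType Y γ] (i : ℕ) :
    IsVarDef Y fun v => v i ∈ codeSet fun _ : γ => True :=
  ArType.arP_true.isVarDef i

theorem ArP.congr {p q : γ → Prop} (hp : ArP Y p) (h : ∀ a, p a ↔ q a) : ArP Y q := by
  rwa [← funext fun a => propext (h a)]

theorem ArP.trans {p : γ → Prop} (hp : ArP Z p) (h : ArReducible Z Y) : ArP Y p :=
  ArReducible.trans hp h

theorem ArF.trans {f : α → β} (hf : ArF Z f) (h : ArReducible Z Y) : ArF Y f :=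
  ArP.trans hf h

theorem ArType.trans [ArType Z γ] (h : ArReducible Z Y) : ArType Y γ :=
  ⟨ArP.trans ArType.arP_true h⟩

theorem ArP.and {p q : γ → Prop} (hp : ArP Y p) (hq : ArP Y q) : ArP Y fun a => p a ∧ q a := by
  refine .of_isVarDef ((hp.isVarDef 0).and (hq.isVarDef 0)) fun v => ⟨?_, ?_⟩
  · rintro ⟨⟨a, ha, hpa⟩, b, hb, hqb⟩
    obtain rfl := code_injective (ha.trans hb.symm)
    exact ⟨a, ha, hpa, hqb⟩
  · rintro ⟨a, ha, hpa, hqa⟩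
    exact ⟨⟨a, ha, hpa⟩, a, ha, hqa⟩

theorem ArP.or {p q : γ → Prop} (hp : ArP Y p) (hq : ArP Y q) : ArP Y fun a => p a ∨ q a :=
  .of_isVarDef ((hp.isVarDef 0).or (hq.isVarDef 0)) fun v => by
    simp only [mem_codeSet, and_or_left, exists_or]

theorem ArP.not [ArType Y γ] {p : γ → Prop} (hp : ArP Y p) : ArP Y fun a => ¬ p a := by
  refine .of_isVarDef ((isVarDef_range γ 0).and (hp.isVarDef 0).not) fun v => ⟨?_, ?_⟩
  · rintro ⟨⟨a, ha, -⟩, h⟩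
    rw [← ha, code_mem_codeSet] at h
    exact ⟨a, ha, h⟩
  · rintro ⟨a, ha, h⟩
    rw [← ha, code_mem_codeSet, code_mem_codeSet]
    exact ⟨trivial, h⟩

theorem ArP.imp [ArType Y γ] {p q : γ → Prop} (hp : ArP Y p) (hq : ArP Y q) :
    ArP Y fun a => p a → q a :=
  (hp.not.or hq).congr fun _ => imp_iff_not_or.symm

theorem ArP.iff [ArType Y γ] {p q : γ → Prop} (hp : ArP Y p) (hq : ArP Y q) :
    ArP Y fun a => p a ↔ q a :=
  ((hp.imp hq).and (hq.imp hp)).congr fun _ => iff_iff_implies_and_implies.symm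

theorem ArP.exists {p : α → β → Prop} (hp : ArP Y fun x : α × β => p x.1 x.2) :
    ArP Y fun a => ∃ b, p a b := by
  refine .of_isVarDef (((isVarDef_pair 0 1 2).and (hp.isVarDef 2)).exists 2 |>.exists 1)
    fun v => ⟨?_, ?_⟩
  · simp only [Function.update, mem_codeSet_prod]
    simp only [mem_codeSet]
    rintro ⟨x, y, h, a, b, rfl, hab⟩
    simp at h
    exact ⟨a, h.1.symm, b, hab⟩
  · rintro ⟨a, ha, b, hab⟩
    refine ⟨code b, code (a, b), ?_⟩
    simpa [← ha] using ⟨rfl, code_mem_codeSet (p := fun x : α × β => p x.1 x.2).2 hab⟩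

theorem ArP.forall [ArType Y α] [ArType Y (α × β)] {p : α → β → Prop}
    (hp : ArP Y fun x : α × β => p x.1 x.2) : ArP Y fun a => ∀ b, p a b :=
  hp.not.exists (p := fun a b => ¬ p a b).not.congr fun _ => by simp

instance : ArType Y ℕ :=
  ⟨.of_isVarDef ((IsTermFun.var 0).eq (IsTermFun.var 0)) fun _ => by simp [mem_codeSet, code]⟩

instance [ArType Y α] [ArType Y β] : ArType Y (α × β) := by
  refine ⟨.of_isVarDef ((((isVarDef_range α 1).and (isVarDef_range β 2)).and
    (isVarDef_pair 1 2 0)).exists 2 |>.exists 1) fun v => ?_⟩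
  simp [mem_codeSet, code_prod]

theorem ArP.comp {p : β → Prop} (hp : ArP Y p) {f : α → β} (hf : ArF Y f) :
    ArP Y fun a => p (f a) := by
  refine .of_isVarDef ((((isVarDef_pair 0 1 2).and (ArP.isVarDef hf 2)).and
    (hp.isVarDef 1)).exists 2 |>.exists 1) fun v => ⟨?_, ?_⟩
  · simp only [Function.update, mem_codeSet_prod]
    simp only [mem_codeSet]
    rintro ⟨x, y, ⟨h, a, _, rfl, rfl⟩, c, hc, hpc⟩
    simp at h hc
    rw [h.2] at hc
    obtain rfl := code_injective hc
    exact ⟨a, h.1.symm, hpc⟩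
  · rintro ⟨a, ha, hab⟩
    refine ⟨code (f a), code (a, f a), ⟨?_, ?_⟩, ?_⟩
    · simp [← ha, code_prod]
    · simpa using code_mem_codeSet (p := fun x : α × β => f x.1 = x.2).2 rfl
    · simpa using code_mem_codeSet.2 hab

@[fun_prop]
theorem ArF.id [ArType Y α] : ArF Y fun a : α => a := by
  refine .of_isVarDef (((isVarDef_range α 1).and (isVarDef_pair 1 1 0)).exists 1) fun v => ?_
  simp [mem_codeSet, code_prod]

@[fun_prop]
theorem ArF.const [ArType Y α] (b : β) : ArF Y fun _ : α => b := by
  refine .of_isVarDef ((((isVarDef_range α 1).and ((IsTermFun.var 2).eq (.const (code b)))).and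
    (isVarDef_pair 1 2 0)).exists 2 |>.exists 1) fun v => ?_
  simp [mem_codeSet, code_prod]

@[fun_prop]
theorem ArF.comp {g : β → γ} {f : α → β} (hg : ArF Y g) (hf : ArF Y f) :
    ArF Y fun a => g (f a) := by
  refine .of_isVarDef ((((((isVarDef_pair 1 2 4).and (ArP.isVarDef hf 4)).and
    (isVarDef_pair 2 3 5)).and (ArP.isVarDef hg 5)).and (isVarDef_pair 1 3 0)).exists 5
      |>.exists 4 |>.exists 3 |>.exists 2 |>.exists 1) fun v => ⟨?_, ?_⟩
  · simp only [Function.update, mem_codeSet_prod]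
    rintro ⟨x₁, x₂, x₃, x₄, x₅, ⟨⟨⟨h₁, a, _, h₂, rfl⟩, h₃⟩, b, _, h₄, rfl⟩, h₅⟩
    simp at h₁ h₂ h₃ h₄ h₅
    obtain ⟨rfl, rfl⟩ := Nat.pair_eq_pair.1 (h₁.trans h₂.symm)
    obtain ⟨h, rfl⟩ := Nat.pair_eq_pair.1 (h₃.trans h₄.symm)
    obtain rfl := code_injective h
    exact ⟨a, _, h₅, rfl⟩
  · simp only [mem_codeSet_prod]
    rintro ⟨a, _, ha, rfl⟩
    refine ⟨code a, code (f a), code (g (f a)), code (a, f a), code (f a, g (f a)), ?_⟩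
    refine ⟨⟨⟨⟨?_, a, _, ?_, rfl⟩, ?_⟩, f a, _, ?_, rfl⟩, ?_⟩ <;> simp [ha, code_prod]

@[fun_prop]
theorem ArF.fst [ArType Y α] [ArType Y β] : ArF Y (Prod.fst : α × β → α) := by
  refine .of_isVarDef (((((isVarDef_range α 1).and (isVarDef_range β 2)).and
    (isVarDef_pair 1 2 3)).and (isVarDef_pair 3 1 0)).exists 3 |>.exists 2 |>.exists 1) fun v => ?_
  simp [mem_codeSet, code_prod]

@[fun_prop]
theorem ArF.snd [ArType Y α] [ArType Y β] : ArF Y (Prod.snd : α × β → β) := by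
  refine .of_isVarDef (((((isVarDef_range α 1).and (isVarDef_range β 2)).and
    (isVarDef_pair 1 2 3)).and (isVarDef_pair 3 2 0)).exists 3 |>.exists 2 |>.exists 1) fun v => ?_
  simp [mem_codeSet, code_prod]

@[fun_prop]
theorem ArF.prodMk {f : α → β} {g : α → γ} (hf : ArF Y f) (hg : ArF Y g) :
    ArF Y fun a => (f a, g a) := by
  refine .of_isVarDef (((((((isVarDef_pair 1 2 4).and (ArP.isVarDef hf 4)).and
    (isVarDef_pair 1 3 5)).and (ArP.isVarDef hg 5)).and (isVarDef_pair 2 3 6)).and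
    (isVarDef_pair 1 6 0)).exists 6 |>.exists 5 |>.exists 4 |>.exists 3 |>.exists 2 |>.exists 1)
    fun v => ⟨?_, ?_⟩
  · simp only [Function.update, mem_codeSet_prod]
    rintro ⟨x₁, x₂, x₃, x₄, x₅, x₆, ⟨⟨⟨⟨h₁, a, _, h₂, rfl⟩, h₃⟩, b, _, h₄, rfl⟩, h₆⟩, h₅⟩
    simp at h₁ h₂ h₃ h₄ h₅ h₆
    obtain ⟨rfl, rfl⟩ := Nat.pair_eq_pair.1 (h₁.trans h₂.symm)
    obtain ⟨h, rfl⟩ := Nat.pair_eq_pair.1 (h₃.trans h₄.symm)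
    obtain rfl := code_injective h
    exact ⟨a, _, by rw [← h₅, ← h₆, code_prod], rfl⟩
  · simp only [mem_codeSet_prod]
    rintro ⟨a, _, ha, rfl⟩
    refine ⟨code a, code (f a), code (g a), code (a, f a), code (a, g a), code (f a, g a), ?_⟩
    refine ⟨⟨⟨⟨⟨?_, a, _, ?_, rfl⟩, ?_⟩, a, _, ?_, rfl⟩, ?_⟩, ?_⟩ <;> simp [← ha, code_prod]

@[fun_prop]
theorem ArF.code [ArType Y α] : ArF Y (code : α → ℕ) := by
  refine .of_isVarDef (((isVarDef_range α 1).and (isVarDef_pair 1 1 0)).exists 1) fun v => ?_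
  simp [mem_codeSet, code_prod, show ∀ n : ℕ, Coded.code n = n from fun _ => rfl]

theorem code_nat (n : ℕ) : code n = n := rfl

theorem arF_add : ArF Y fun x : ℕ × ℕ => x.1 + x.2 := by
  refine .of_isVarDef ((((((IsTermFun.var 1).add (IsTermFun.var 2)).eq (.var 3)).and
    (isVarDef_pair 1 2 4)).and (isVarDef_pair 4 3 0)).exists 4 |>.exists 3 |>.exists 2
      |>.exists 1) fun v => ?_
  simp [mem_codeSet, code_prod, code_nat]

theorem arF_mul : ArF Y fun x : ℕ × ℕ => x.1 * x.2 := by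
  refine .of_isVarDef ((((((IsTermFun.var 1).mul (IsTermFun.var 2)).eq (.var 3)).and
    (isVarDef_pair 1 2 4)).and (isVarDef_pair 4 3 0)).exists 4 |>.exists 3 |>.exists 2
      |>.exists 1) fun v => ?_
  simp [mem_codeSet, code_prod, code_nat]

theorem arP_lt : ArP Y fun x : ℕ × ℕ => x.1 < x.2 := by
  refine .of_isVarDef ((((IsTermFun.var 1).lt (IsTermFun.var 2)).and
    (isVarDef_pair 1 2 0)).exists 2 |>.exists 1) fun v => ?_
  simp [mem_codeSet, code_prod, code_nat, and_comm]

theorem ArReducible.arP_mem {X : Set ℕ} (h : ArReducible X Y) : ArP Y fun n : ℕ => n ∈ X := by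
  refine .of_isVarDef (h.isVarDef 0) fun v => ?_
  simp [mem_codeSet, code_nat]

theorem ArP.arReducible {X : Set ℕ} (h : ArP Y fun n : ℕ => n ∈ X) : ArReducible X Y := by
  have : codeSet (fun n : ℕ => n ∈ X) = X := by ext; simp [mem_codeSet, code_nat]
  rwa [ArP, this] at h

theorem ArP.comp₂ {R : α → β → Prop} (hR : ArP Y fun x : α × β => R x.1 x.2) {f : γ → α}
    {g : γ → β} (hf : ArF Y f) (hg : ArF Y g) : ArP Y fun c => R (f c) (g c) :=
  hR.comp (hf.prodMk hg)

theorem ArP.eq [ArType Y α] {f g : γ → α} (hf : ArF Y f) (hg : ArF Y g) :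
    ArP Y fun c => f c = g c :=
  ArP.comp₂ (R := fun a b : α => a = b) ArF.id hf hg

@[fun_prop]
theorem ArF.add {f g : γ → ℕ} (hf : ArF Y f) (hg : ArF Y g) : ArF Y fun c => f c + g c :=
  arF_add.comp (hf.prodMk hg)

@[fun_prop]
theorem ArF.mul {f g : γ → ℕ} (hf : ArF Y f) (hg : ArF Y g) : ArF Y fun c => f c * g c :=
  arF_mul.comp (hf.prodMk hg)

theorem ArP.lt {f g : γ → ℕ} (hf : ArF Y f) (hg : ArF Y g) : ArP Y fun c => f c < g c :=
  ArP.comp₂ (R := (· < ·)) arP_lt hf hg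

theorem arF_pair : ArF Y fun x : ℕ × ℕ => Nat.pair x.1 x.2 := ArF.code

@[fun_prop]
theorem ArF.pair {f g : γ → ℕ} (hf : ArF Y f) (hg : ArF Y g) :
    ArF Y fun c => Nat.pair (f c) (g c) :=
  arF_pair.comp (hf.prodMk hg)

end

/-! ## Inductive definitions and recursion -/

/-- The closure of the predicate `base` under the relation `op y z x`, read as
`x` is obtained from `y` and `z`. -/
inductive Clo {β : Type*} (base : β → Prop) (op : β → β → β → Prop) : β → Prop
  | base {x : β} : base x → Clo base op x
  | op {x y z : β} : Clo base op y → Clo base op z → op y z x → Clo base op x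

/-- Derivations, in reverse order, of membership in the closure. -/
inductive Derivation {β : Type*} (base : β → Prop) (op : β → β → β → Prop) : List β → Prop
  | nil : Derivation base op []
  | cons {x : β} {l : List β} : Derivation base op l →
      (base x ∨ ∃ y ∈ l, ∃ z ∈ l, op y z x) → Derivation base op (x :: l)

section Derivation

variable {β : Type*} {base : β → Prop} {op : β → β → β → Prop}

theorem Derivation.append {l₁ l₂ : List β} (h₁ : Derivation base op l₁)
    (h₂ : Derivation base op l₂) : Derivation base op (l₁ ++ l₂) := by
  induction h₁ with
  | nil => exact h₂
  | cons _ hx ih =>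
    refine ih.cons (hx.imp_right ?_)
    rintro ⟨y, hy, z, hz, h⟩
    exact ⟨y, List.mem_append_left _ hy, z, List.mem_append_left _ hz, h⟩

theorem Clo.exists_derivation {x : β} (h : Clo base op x) :
    ∃ l, Derivation base op (x :: l) := by
  induction h with
  | base h => exact ⟨[], .cons .nil (.inl h)⟩
  | @op _ y z _ _ h ihy ihz =>
    obtain ⟨l₁, h₁⟩ := ihy
    obtain ⟨l₂, h₂⟩ := ihz
    exact ⟨_, (h₁.append h₂).cons (.inr ⟨y, by simp, z, by simp, h⟩)⟩

theorem Derivation.getElem {l : List β} (h : Derivation base op l) (i : ℕ) (hi : i < l.length) :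
    base l[i] ∨ ∃ j k, i < j ∧ i < k ∧ ∃ (hj : j < l.length) (hk : k < l.length),
      op l[j] l[k] l[i] := by
  induction h generalizing i with
  | nil => simp at hi
  | @cons x l hl hx ih =>
    cases i with
    | zero =>
      refine hx.imp_right ?_
      rintro ⟨y, hy, z, hz, h⟩
      obtain ⟨j, hj, rfl⟩ := List.getElem_of_mem hy
      obtain ⟨k, hk, rfl⟩ := List.getElem_of_mem hz
      exact ⟨j + 1, k + 1, by simp, by simp, by simpa, by simpa, by simpa⟩
    | succ i =>
      refine (ih i (by simpa using hi)).imp_right ?_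
      rintro ⟨j, k, hij, hik, hj, hk, h⟩
      exact ⟨j + 1, k + 1, by simpa, by simpa, by simpa, by simpa, by simpa⟩

end Derivation

theorem clo_iff_beta {β : Type} [Coded β] {base : β → Prop} {op : β → β → β → Prop} {b : β} :
    Clo base op b ↔ ∃ c n : ℕ, Nat.beta c 0 = code b ∧ ∀ i, i < n + 1 →
      ∃ x, code x = Nat.beta c i ∧ (base x ∨ ∃ j k, (i < j ∧ i < k ∧ j < n + 1 ∧ k < n + 1) ∧
        ∃ y z, (code y = Nat.beta c j ∧ code z = Nat.beta c k) ∧ op y z x) := by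
  constructor
  · intro h
    obtain ⟨l, hl⟩ := h.exists_derivation
    have key (i : ℕ) (hi : i < l.length + 1) :
        Nat.beta (Nat.unbeta ((b :: l).map code)) i = code (b :: l)[i] := by
      have := Nat.beta_unbeta_coe ((b :: l).map code) ⟨i, by simpa using hi⟩
      simp only at this
      rw [this]
      simp [-List.map_cons]
    refine ⟨Nat.unbeta ((b :: l).map code), l.length, key 0 (by simp), fun i hi => ?_⟩
    refine ⟨_, (key i hi).symm, (hl.getElem i hi).imp_right ?_⟩
    rintro ⟨j, k, hij, hik, hj, hk, h⟩
    exact ⟨j, k, ⟨hij, hik, hj, hk⟩, _, _, ⟨(key j hj).symm, (key k hk).symm⟩, h⟩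
  · rintro ⟨c, n, hb, h⟩
    have key (m : ℕ) : ∀ i, i < n + 1 → n - i ≤ m → ∀ x, code x = Nat.beta c i →
        Clo base op x := by
      induction m with
      | zero =>
        intro i hi him x hx
        obtain ⟨x', hx', h | ⟨j, k, hjk, -⟩⟩ := h i hi
        · obtain rfl := code_injective (hx.trans hx'.symm)
          exact .base h
        · omega
      | succ m ih =>
        intro i hi him x hx
        obtain ⟨x', hx', h | ⟨j, k, hjk, y, z, ⟨hy, hz⟩, h⟩⟩ := h i hi
        · obtain rfl := code_injective (hx.trans hx'.symm)
          exact .base h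
        · obtain rfl := code_injective (hx.trans hx'.symm)
          exact .op (ih j (by omega) (by omega) y hy) (ih k (by omega) (by omega) z hz) h
    exact key n 0 (by simp) (by simp) b hb.symm

section

variable {Y : Set ℕ} {α β γ σ : Type} [Coded α] [Coded β] [Coded γ] [Coded σ]

theorem ArF.of_code [ArType Y α] [ArType Y β] {f : α → β}
    (hf : ArF Y fun a => Coded.code (f a)) :
    ArF Y f :=
  (ArP.eq (f := fun x : α × β => Coded.code (f x.1)) (g := fun x : α × β => Coded.code x.2)
    (hf.comp .fst) (by fun_prop)).congr fun x => code_injective.eq_iff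

theorem ArType.of_surjective [ArType Y α] {e : α → β} (he : Function.Surjective e)
    (h : ArF Y fun a => code (e a)) : ArType Y β := by
  have : ArP Y fun n : ℕ => ∃ a, code (e a) = n :=
    ArP.exists (p := fun n a => code (e a) = n) (.eq (h.comp .snd) .fst)
  refine ⟨ArP.of_isVarDef (this.isVarDef 0) fun v => ?_⟩
  simp [mem_codeSet, code_nat, he.exists]

theorem arF_beta : ArF Y fun x : ℕ × ℕ => Nat.beta x.1 x.2 := by
  have : ArP Y fun x : (ℕ × ℕ) × ℕ => ∃ a b q : ℕ, Nat.pair a b = x.1.1 ∧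
      a = q * ((x.1.2 + 1) * b + 1) + x.2 ∧ x.2 < (x.1.2 + 1) * b + 1 := by
    refine .exists <| .exists <| .exists <| .and (.eq ?_ ?_) (.and (.eq ?_ ?_) (.lt ?_ ?_)) <;>
      fun_prop
  refine this.congr fun x => ?_
  obtain ⟨⟨n, i⟩, y⟩ := x
  simp only [Nat.beta]
  constructor
  · rintro ⟨a, b, q, rfl, rfl, h⟩
    simp only [Nat.unpair_pair] at h ⊢
    rw [Nat.add_comm, Nat.add_mul_mod_self_right, Nat.mod_eq_of_lt h]
  · rintro rfl
    exact ⟨_, _, _, Nat.pair_unpair n, (Nat.div_add_mod' _ _).symm, Nat.mod_lt _ (by simp)⟩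

@[fun_prop]
theorem ArF.beta {f g : γ → ℕ} (hf : ArF Y f) (hg : ArF Y g) :
    ArF Y fun c => Nat.beta (f c) (g c) :=
  arF_beta.comp (hf.prodMk hg)

theorem ArP.clo [ArType Y α] [ArType Y β] {base : α → β → Prop} {op : α → β → β → β → Prop}
    (hbase : ArP Y fun x : α × β => base x.1 x.2)
    (hop : ArP Y fun x : α × β × β × β => op x.1 x.2.1 x.2.2.1 x.2.2.2) :
    ArP Y fun x : α × β => Clo (base x.1) (op x.1) x.2 := by
  refine ArP.congr ?_ fun x => clo_iff_beta.symm
  refine .exists <| .exists <| .and (.eq ?_ ?_) <| .forall <| .imp (.lt ?_ ?_) <| .exists <|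
    .and (.eq ?_ ?_) <| .or (hbase.comp₂ ?_ ?_) <| .exists <| .exists <|
    .and (.and (.lt ?_ ?_) <| .and (.lt ?_ ?_) <| .and (.lt ?_ ?_) (.lt ?_ ?_)) <|
    .exists <| .exists <| .and (.and (.eq ?_ ?_) (.eq ?_ ?_))
    (hop.comp (f := fun x : (((((((((α × β) × ℕ) × ℕ) × ℕ) × β) × ℕ) × ℕ) × β) × β) =>
      (x.1.1.1.1.1.1.1.1.1, x.1.2, x.2, x.1.1.1.1.2)) ?_) <;> fun_prop

theorem arF_iterate [ArType Y σ] (s : σ) {step : ℕ → σ → σ}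
    (h : ArF Y fun x : ℕ × σ => step x.1 x.2) :
    ArF Y fun n => Nat.rec (motive := fun _ => σ) s step n := by
  have : ArP Y fun x : ℕ × (ℕ × σ) => Clo (fun z => z = (0, s))
      (fun y _ z => z = (y.1 + 1, step y.1 y.2)) x.2 := by
    refine ArP.clo (α := ℕ) (base := fun _ z => z = ((0, s) : ℕ × σ))
      (op := fun _ y _ z => z = (y.1 + 1, step y.1 y.2)) (.eq ?_ ?_) (.eq ?_ (.prodMk ?_
        (h.comp (f := fun x : ℕ × (ℕ × σ) × (ℕ × σ) × (ℕ × σ) => x.2.1) ?_))) <;> fun_prop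
  refine (this.comp (f := fun x : ℕ × σ => (0, x)) (by fun_prop)).congr ?_
  rintro ⟨n, x⟩
  constructor
  · intro h
    have (z : ℕ × σ) (hz : Clo (fun z => z = (0, s))
        (fun y _ z => z = (y.1 + 1, step y.1 y.2)) z) :
        Nat.rec (motive := fun _ => σ) s step z.1 = z.2 := by
      induction hz with
      | base h => subst h; rfl
      | op _ _ h ih _ => subst h; simp only [ih]
    exact this _ h
  · intro h
    simp only at h
    subst h
    simp only
    induction n with
    | zero => exact .base rfl
    | succ n ih => exact .op ih ih rfl

theorem ArP.exists_choice [ArType Y α] [ArType Y β] {P : α → β → Prop}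
    (hP : ArP Y fun x : α × β => P x.1 x.2) (h : ∀ a, ∃ b, P a b) :
    ∃ f : α → β, ArF Y f ∧ ∀ a, P a (f a) := by
  have (a : α) : ∃ b, P a b ∧ ∀ b', P a b' → ¬ code b' < code b := by
    obtain ⟨b, hb, hb'⟩ := (measure (code : β → ℕ)).wf.has_min {b | P a b} (h a)
    exact ⟨b, hb, hb'⟩
  choose f hf hf' using this
  have hg : ArP Y fun x : α × β => P x.1 x.2 ∧ ∀ b', P x.1 b' → ¬ code b' < code x.2 := by
    refine hP.and <| .forall <| .imp (hP.comp₂ ?_ ?_) <| .not <| .lt ?_ ?_ <;> fun_prop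
  refine ⟨f, hg.congr fun x => ⟨?_, ?_⟩, hf⟩
  · rintro ⟨h₁, h₂⟩
    have h₃ := hf' x.1 _ h₁
    have h₄ := h₂ _ (hf x.1)
    exact code_injective (by omega)
  · intro h
    rw [← h]
    exact ⟨hf _, hf' _⟩

end

/-! ## Lists and tuples -/

instance {γ : Type} [Coded γ] : Coded (List γ) where
  code l := listCode (l.map code)
  code_injective := Encodable.encode_injective.comp code_injective.list_map

instance {γ : Type} [Coded γ] {n : ℕ} : Coded (Fin n → γ) where
  code v := tupleCode fun i => code (v i)
  code_injective v w h := by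
    have := List.ofFn_injective (Encodable.encode_injective h)
    exact funext fun i => code_injective (congrFun this i)

section

variable {Y : Set ℕ} {α β γ : Type} [Coded α] [Coded β] [Coded γ]

theorem code_cons (a : γ) (l : List γ) : code (a :: l) = Nat.pair (code a) (code l) + 1 := rfl

theorem code_finCons {n : ℕ} (a : γ) (v : Fin n → γ) :
    code (Fin.cons a v : Fin (n + 1) → γ) = Nat.pair (code a) (code v) + 1 := by
  simp [Coded.code, tupleCode, listCode, List.ofFn_succ]

instance [ArType Y γ] : ArType Y (List γ) := by
  have : ArP Y fun x : ℕ × ℕ => Clo (fun z => z = 0)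
      (fun y _ z => ∃ a : γ, z = Nat.pair (code a) y + 1) x.2 := by
    refine ArP.clo (α := ℕ) (base := fun _ z => z = 0)
      (op := fun _ y _ z => ∃ a : γ, z = Nat.pair (code a) y + 1) (.eq ?_ ?_)
        (.exists <| .eq ?_ ?_) <;> fun_prop
  refine ⟨ArP.of_isVarDef ((this.comp (f := fun x : ℕ => (0, x)) (by fun_prop)).isVarDef 0)
    fun v => ?_⟩
  simp only [mem_codeSet, code_nat, exists_eq_left, and_true]
  constructor
  · generalize v 0 = m
    intro h
    induction h with
    | base h => subst h; exact ⟨[], rfl⟩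
    | op _ _ h ih _ =>
      obtain ⟨a, rfl⟩ := h
      obtain ⟨l, rfl⟩ := ih
      exact ⟨a :: l, rfl⟩
  · rintro ⟨l, h⟩
    rw [← h]
    clear h
    induction l with
    | nil => exact .base rfl
    | cons a l ih => exact .op ih ih ⟨a, rfl⟩

theorem arF_cons [ArType Y γ] : ArF Y fun x : γ × List γ => x.1 :: x.2 := by
  refine .of_code ?_
  simp only [code_cons]
  fun_prop

@[fun_prop]
theorem ArF.cons [ArType Y γ] {f : α → γ} {g : α → List γ} (hf : ArF Y f) (hg : ArF Y g) :
    ArF Y fun a => f a :: g a :=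
  arF_cons.comp (hf.prodMk hg)

theorem arP_mem [ArType Y γ] : ArP Y fun x : γ × List γ => x.1 ∈ x.2 := by
  have : ArP Y fun x : List γ × List γ => Clo (fun z => z = x.1)
      (fun y _ z => ∃ a : γ, y = a :: z) x.2 := by
    refine ArP.clo (base := fun x z => z = x)
      (op := fun _ y _ z => ∃ a : γ, y = a :: z) (.eq ?_ ?_)
        (.exists <| .eq ?_ ?_) <;> fun_prop
  have : ArP Y fun x : γ × List γ => ∃ l : List γ, Clo (fun z => z = x.2)
      (fun y _ z => ∃ a : γ, y = a :: z) (x.1 :: l) := by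
    refine .exists <| this.comp (f := fun z : (γ × List γ) × List γ => (z.1.2, z.1.1 :: z.2)) ?_
    fun_prop
  refine this.congr ?_
  rintro ⟨a, l⟩
  have key (m : List γ) : Clo (fun z => z = l) (fun y _ z => ∃ a : γ, y = a :: z) m ↔
      m <:+ l := by
    constructor
    · intro h
      induction h with
      | base h => exact h ▸ List.suffix_refl _
      | op _ _ h ih _ =>
        obtain ⟨a, rfl⟩ := h
        exact (List.suffix_cons _ _).trans ih
    · rintro ⟨t, ht⟩
      induction t using List.reverseRecOn generalizing m with
      | nil => exact .base ht
      | append_singleton t b ih =>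
        have := ih (b :: m) (by simpa using ht)
        exact .op this this ⟨b, rfl⟩
  simp only [key]
  constructor
  · rintro ⟨l', h⟩
    exact h.subset (by simp)
  · intro h
    obtain ⟨s, t, h⟩ := List.append_of_mem h
    exact ⟨t, s, h.symm⟩

theorem ArP.mem [ArType Y γ] {f : α → γ} {g : α → List γ} (hf : ArF Y f) (hg : ArF Y g) :
    ArP Y fun a => f a ∈ g a :=
  arP_mem.comp (hf.prodMk hg)

instance [ArType Y γ] {n : ℕ} : ArType Y (Fin n → γ) := by
  induction n with
  | zero => 
    refine .of_surjective (α := ℕ) (e := fun _ => Fin.elim0)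
      (fun v => ⟨0, Subsingleton.elim _ _⟩) ?_
    fun_prop
  | succ n ih =>
    refine .of_surjective (α := γ × (Fin n → γ)) (e := fun x => Fin.cons x.1 x.2)
      (fun v => ⟨(v 0, Fin.tail v), Fin.cons_self_tail v⟩) ?_
    simp only [code_finCons]
    fun_prop

theorem arF_finCons [ArType Y γ] {n : ℕ} :
    ArF Y fun x : γ × (Fin n → γ) => (Fin.cons x.1 x.2 : Fin (n + 1) → γ) := by
  refine .of_code ?_
  simp only [code_finCons]
  fun_prop

@[fun_prop]
theorem ArF.finCons [ArType Y γ] {n : ℕ} {f : α → γ} {g : α → Fin n → γ} (hf : ArF Y f)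
    (hg : ArF Y g) : ArF Y fun a => (Fin.cons (f a) (g a) : Fin (n + 1) → γ) :=
  arF_finCons.comp (hf.prodMk hg)

theorem arF_finTail [ArType Y γ] {n : ℕ} :
    ArF Y fun v : Fin (n + 1) → γ => Fin.tail v := by
  have : ArP Y fun x : (Fin (n + 1) → γ) × (Fin n → γ) => ∃ a : γ, Fin.cons a x.2 = x.1 := by
    refine .exists <| .eq ?_ ?_ <;> fun_prop
  refine this.congr fun x => ⟨?_, ?_⟩
  · rintro ⟨a, h⟩
    simp only [← h, Fin.tail_cons]
  · intro h
    exact ⟨x.1 0, by rw [← h, Fin.cons_self_tail]⟩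

@[fun_prop]
theorem arF_apply [ArType Y γ] {n : ℕ} (i : Fin n) : ArF Y fun v : Fin n → γ => v i := by
  induction n with
  | zero => exact i.elim0
  | succ n ih =>
    induction i using Fin.cases with
    | zero =>
      have : ArP Y fun x : (Fin (n + 1) → γ) × γ => ∃ w : Fin n → γ, Fin.cons x.2 w = x.1 := by
        refine .exists <| .eq ?_ ?_ <;> fun_prop
      refine this.congr fun x => ⟨?_, ?_⟩
      · rintro ⟨a, h⟩
        simp only [← h, Fin.cons_zero]
      · intro h
        exact ⟨Fin.tail x.1, by rw [← h, Fin.cons_self_tail]⟩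
    | succ i => exact (ih i).comp arF_finTail

theorem ArF.pi [ArType Y α] [ArType Y γ] {n : ℕ} {f : α → Fin n → γ}
    (hf : ∀ i, ArF Y fun a => f a i) : ArF Y f := by
  induction n with
  | zero =>
    rw [show f = fun _ => Fin.elim0 from funext fun _ => Subsingleton.elim _ _]
    fun_prop
  | succ n ih =>
    have := (hf 0).finCons (ih (f := fun a => Fin.tail (f a)) fun i => hf i.succ)
    simpa only [Fin.cons_self_tail] using this

theorem ArP.forall_fin [ArType Y α] {n : ℕ} {p : Fin n → α → Prop} (hp : ∀ i, ArP Y (p i)) :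
    ArP Y fun a => ∀ i, p i a := by
  induction n with
  | zero => exact ArType.arP_true.congr fun _ => by simp
  | succ n ih =>
    exact ((hp 0).and (ih fun i => hp i.succ)).congr fun _ =>
      (Fin.forall_fin_succ (P := fun i => p i _)).symm

end

/-! ## Finite partial isomorphisms between fields -/

section Algebra

open Polynomial

variable {K E F : Type} [Field K] [Field E] [Field F] [Algebra K E] [Algebra K F]

theorem exists_eval₂_eq_zero_iff [IsAlgClosed F] {R : Type} [CommRing R] (i : R →+* E)
    (j : R →+* F) (hi : Function.Injective i) (hj : Function.Injective j) {x : E}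
    (hx : ∃ P : R[X], P ≠ 0 ∧ P.eval₂ i x = 0) :
    ∃ y, ∀ P : R[X], P.eval₂ i x = 0 ↔ P.eval₂ j y = 0 := by
  let := i.toAlgebra
  let := j.toAlgebra
  have : IsDomain R := hi.isDomain i
  have hx : IsAlgebraic R x := hx
  let S := Algebra.adjoin R {x}
  have : Algebra.IsAlgebraic R S :=
    (Subalgebra.isAlgebraic_iff _).1 (Algebra.isAlgebraic_adjoin_singleton_iff.2 hx)
  have : FaithfulSMul R F := (faithfulSMul_iff_algebraMap_injective R F).2 hj
  have : FaithfulSMul R E := (faithfulSMul_iff_algebraMap_injective R E).2 hi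
  have : FaithfulSMul R S := inferInstance
  let f : S →ₐ[R] F := IsAlgClosed.lift
  have hf (a : S) (ha : f a = 0) : a = 0 := by
    by_contra h
    obtain ⟨q, hq, hq'⟩ := (Algebra.IsAlgebraic.isAlgebraic (R := R) a)
      |>.exists_nonzero_coeff_and_aeval_eq_zero (mem_nonZeroDivisors_of_ne_zero h)
    apply hq
    have := congrArg f hq'
    rw [← aeval_algHom_apply, ha, map_zero, ← coeff_zero_eq_aeval_zero'] at this
    exact hj (this.trans (map_zero _).symm)
  let x' : S := ⟨x, Algebra.self_mem_adjoin_singleton R x⟩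
  refine ⟨f x', fun P => ?_⟩
  change aeval (S.val x') P = 0 ↔ aeval (f x') P = 0
  rw [aeval_algHom_apply, aeval_algHom_apply]
  constructor
  · intro h
    rw [show aeval x' P = 0 from Subtype.val_injective h, map_zero]
  · intro h
    rw [hf _ h, map_zero]

/-- A set of pairs is good over `K` if the two coordinates satisfy the same polynomial equations
over `K`. -/
def Good (K : Type) {E F : Type} [Field K] [Field E] [Field F] [Algebra K E] [Algebra K F]
    (s : Set (E × F)) : Prop :=
  ∀ z ∈ Algebra.adjoin K s, z.1 = 0 ↔ z.2 = 0

variable {s t : Set (E × F)}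

theorem Good.mono (ht : Good K t) (h : s ⊆ t) : Good K s :=
  fun z hz => ht z (Algebra.adjoin_mono h hz)

theorem good_empty : Good K (∅ : Set (E × F)) := by
  intro z hz
  rw [Algebra.adjoin_empty, Algebra.mem_bot] at hz
  obtain ⟨k, rfl⟩ := hz
  simp

theorem Good.swap (hs : Good K s) : Good K (Prod.swap '' s) := by
  intro z hz
  have h : (AlgHom.prod (AlgHom.snd K E F) (AlgHom.fst K E F)) '' s = Prod.swap '' s := rfl
  rw [← h, ← AlgHom.map_adjoin] at hz
  obtain ⟨w, hw, rfl⟩ := hz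
  exact (hs w hw).symm

theorem Good.fst_eq_iff (hs : Good K s) {z w : E × F} (hz : z ∈ Algebra.adjoin K s)
    (hw : w ∈ Algebra.adjoin K s) : z.1 = w.1 ↔ z.2 = w.2 := by
  simpa [sub_eq_zero] using hs _ (sub_mem hz hw)

/-- The projection of the algebra generated by a set of pairs to the first coordinate. -/
def adjoinFst (s : Set (E × F)) : Algebra.adjoin K s →+* E :=
  (RingHom.fst E F).comp (Algebra.adjoin K s).val.toRingHom

/-- The projection of the algebra generated by a set of pairs to the second coordinate. -/
def adjoinSnd (s : Set (E × F)) : Algebra.adjoin K s →+* F :=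
  (RingHom.snd E F).comp (Algebra.adjoin K s).val.toRingHom

theorem Good.adjoinFst_injective (hs : Good K s) :
    Function.Injective (adjoinFst (K := K) s) := fun z w h =>
  Subtype.ext (Prod.ext h ((hs.fst_eq_iff z.2 w.2).1 h))

theorem Good.adjoinSnd_injective (hs : Good K s) :
    Function.Injective (adjoinSnd (K := K) s) := fun z w h =>
  Subtype.ext (Prod.ext ((hs.fst_eq_iff z.2 w.2).2 h) h)

theorem good_insert_of_eval₂ {x : E} {y : F}
    (h : ∀ P : (Algebra.adjoin K s)[X],
      P.eval₂ (adjoinFst s) x = 0 ↔ P.eval₂ (adjoinSnd s) y = 0) :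
    Good K (insert (x, y) s) := by
  intro z hz
  obtain ⟨P, h₁, h₂⟩ : ∃ P : (Algebra.adjoin K s)[X],
      P.eval₂ (adjoinFst s) x = z.1 ∧ P.eval₂ (adjoinSnd s) y = z.2 := by
    induction hz using Algebra.adjoin_induction with
    | mem z hz =>
      obtain rfl | hz := hz
      · exact ⟨X, by simp, by simp⟩
      · refine ⟨C ⟨z, Algebra.subset_adjoin hz⟩, by simp [adjoinFst], by simp [adjoinSnd]⟩
    | algebraMap k =>
      refine ⟨C (algebraMap K _ k), by simp [adjoinFst], by simp [adjoinSnd]⟩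
    | add a b _ _ ha hb =>
      obtain ⟨P, h₁, h₂⟩ := ha
      obtain ⟨Q, h₃, h₄⟩ := hb
      exact ⟨P + Q, by simp [eval₂_add, *], by simp [eval₂_add, *]⟩
    | mul a b _ _ ha hb =>
      obtain ⟨P, h₁, h₂⟩ := ha
      obtain ⟨Q, h₃, h₄⟩ := hb
      exact ⟨P * Q, by simp [eval₂_mul, *], by simp [eval₂_mul, *]⟩
  rw [← h₁, ← h₂, h]

theorem Good.eval₂_snd_ne_zero (hs : Good K s) {y : F}
    (hy : Transcendental (Algebra.adjoin K (Prod.snd '' s)) y) {P : (Algebra.adjoin K s)[X]}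
    (hP : P ≠ 0) : P.eval₂ (adjoinSnd s) y ≠ 0 := by
  have hmem (z : Algebra.adjoin K s) : adjoinSnd s z ∈ Algebra.adjoin K (Prod.snd '' s) := by
    have : Prod.snd '' s = AlgHom.snd K E F '' s := rfl
    rw [this, ← AlgHom.map_adjoin]
    exact ⟨_, z.2, rfl⟩
  let f : Algebra.adjoin K s →+* Algebra.adjoin K (Prod.snd '' s) :=
    (adjoinSnd s).codRestrict (Algebra.adjoin K (Prod.snd '' s)) hmem
  have hf : Function.Injective f := fun z w h => hs.adjoinSnd_injective (congrArg Subtype.val h)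
  intro h
  apply hP
  apply Polynomial.map_injective f hf
  rw [Polynomial.map_zero]
  apply (transcendental_iff.1 hy)
  rw [aeval_def, eval₂_map]
  exact h

theorem Good.eval₂_fst_ne_zero (hs : Good K s) {x : E}
    (hx : Transcendental (Algebra.adjoin K (Prod.fst '' s)) x) {P : (Algebra.adjoin K s)[X]}
    (hP : P ≠ 0) : P.eval₂ (adjoinFst s) x ≠ 0 := by
  have hmem (z : Algebra.adjoin K s) : adjoinFst s z ∈ Algebra.adjoin K (Prod.fst '' s) := by
    have : Prod.fst '' s = AlgHom.fst K E F '' s := rfl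
    rw [this, ← AlgHom.map_adjoin]
    exact ⟨_, z.2, rfl⟩
  let f : Algebra.adjoin K s →+* Algebra.adjoin K (Prod.fst '' s) :=
    (adjoinFst s).codRestrict (Algebra.adjoin K (Prod.fst '' s)) hmem
  have hf : Function.Injective f := fun z w h => hs.adjoinFst_injective (congrArg Subtype.val h)
  intro h
  apply hP
  apply Polynomial.map_injective f hf
  rw [Polynomial.map_zero]
  apply (transcendental_iff.1 hx)
  rw [aeval_def, eval₂_map]
  exact h

theorem Good.insert_of_transcendental (hs : Good K s) {x : E} {y : F}
    (hx : Transcendental (Algebra.adjoin K (Prod.fst '' s)) x)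
    (hy : Transcendental (Algebra.adjoin K (Prod.snd '' s)) y) :
    Good K (insert (x, y) s) := by
  refine good_insert_of_eval₂ fun P => ?_
  by_cases hP : P = 0
  · simp [hP]
  · exact iff_of_false (hs.eval₂_fst_ne_zero hx hP) (hs.eval₂_snd_ne_zero hy hP)

variable (K) in
/-- No finite subset of `F` generates a field over which `F` is algebraic. -/
def InfTrdeg (F : Type) [Field F] [Algebra K F] : Prop :=
  ∀ t : Set F, t.Finite → ∃ y : F, Transcendental (Algebra.adjoin K t) y

theorem Good.exists_insert [IsAlgClosed F] (hF : InfTrdeg K F) (hs : Good K s) (hfin : s.Finite)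
    (x : E) : ∃ y, Good K (insert (x, y) s) := by
  by_cases hx : ∃ P : (Algebra.adjoin K s)[X], P ≠ 0 ∧ P.eval₂ (adjoinFst s) x = 0
  · obtain ⟨y, hy⟩ := exists_eval₂_eq_zero_iff _ (adjoinSnd s) hs.adjoinFst_injective
      hs.adjoinSnd_injective hx
    exact ⟨y, good_insert_of_eval₂ hy⟩
  · obtain ⟨y, hy⟩ := hF _ (hfin.image Prod.snd)
    refine ⟨y, good_insert_of_eval₂ fun P => ?_⟩
    by_cases hP : P = 0
    · simp [hP]
    · exact iff_of_false (fun h => hx ⟨P, hP, h⟩) (hs.eval₂_snd_ne_zero hy hP)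

theorem Good.exists_insert_left [IsAlgClosed E] (hE : InfTrdeg K E) (hs : Good K s)
    (hfin : s.Finite) (y : F) : ∃ x, Good K (insert (x, y) s) := by
  obtain ⟨x, hx⟩ := hs.swap.exists_insert hE (hfin.image _) y
  refine ⟨x, hx.swap.mono ?_⟩
  simp [Set.image_insert_eq, Set.image_image]

section Realize

open FirstOrder.Ring

variable [CompatibleRing E] [CompatibleRing F]

theorem realize_term_mem_adjoin {α : Type} (τ : Language.ring.Term α) {v : α → E} {w : α → F}
    (h : ∀ i, (v i, w i) ∈ s) : (τ.realize v, τ.realize w) ∈ Algebra.adjoin K s := by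
  induction τ with
  | var i => exact Algebra.subset_adjoin (h i)
  | func f ts ih =>
    cases f with
    | add =>
      have h₁ := CompatibleRing.funMap_add (R := E) fun i => (ts i).realize v
      have h₂ := CompatibleRing.funMap_add (R := F) fun i => (ts i).realize w
      have := add_mem (ih 0) (ih 1)
      rw [Prod.mk_add_mk, ← h₁, ← h₂] at this
      exact this
    | mul =>
      have h₁ := CompatibleRing.funMap_mul (R := E) fun i => (ts i).realize v
      have h₂ := CompatibleRing.funMap_mul (R := F) fun i => (ts i).realize w
      have := mul_mem (ih 0) (ih 1)
      rw [Prod.mk_mul_mk, ← h₁, ← h₂] at this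
      exact this
    | neg =>
      have h₁ := CompatibleRing.funMap_neg (R := E) fun i => (ts i).realize v
      have h₂ := CompatibleRing.funMap_neg (R := F) fun i => (ts i).realize w
      have := neg_mem (ih 0)
      rw [Prod.neg_mk, ← h₁, ← h₂] at this
      exact this
    | zero =>
      have h₁ := CompatibleRing.funMap_zero (R := E) fun i => (ts i).realize v
      have h₂ := CompatibleRing.funMap_zero (R := F) fun i => (ts i).realize w
      have := zero_mem (Algebra.adjoin K s)
      rw [Prod.zero_eq_mk, ← h₁, ← h₂] at this
      exact this
    | one =>
      have h₁ := CompatibleRing.funMap_one (R := E) fun i => (ts i).realize v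
      have h₂ := CompatibleRing.funMap_one (R := F) fun i => (ts i).realize w
      have := one_mem (Algebra.adjoin K s)
      rw [Prod.one_eq_mk, ← h₁, ← h₂] at this
      exact this

theorem Good.realize_iff [IsAlgClosed E] [IsAlgClosed F] (hE : InfTrdeg K E)
    (hF : InfTrdeg K F) {α : Type} {n : ℕ} (φ : Language.ring.BoundedFormula α n)
    {v : α → E} {w : α → F} {xs : Fin n → E} {ys : Fin n → F} (hs : Good K s)
    (hfin : s.Finite) (hv : ∀ i, (v i, w i) ∈ s) (hxs : ∀ i, (xs i, ys i) ∈ s) :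
    φ.Realize v xs ↔ φ.Realize w ys := by
  induction φ generalizing s with
  | falsum => rfl
  | equal t₁ t₂ =>
    have h : ∀ i, (Sum.elim v xs i, Sum.elim w ys i) ∈ s := by
      rintro (i | i)
      · exact hv i
      · exact hxs i
    exact hs.fst_eq_iff (realize_term_mem_adjoin t₁ h) (realize_term_mem_adjoin t₂ h)
  | rel R => cases R
  | imp _ _ ih₁ ih₂ =>
    exact imp_congr (ih₁ hs hfin hv hxs) (ih₂ hs hfin hv hxs)
  | all φ ih =>
    have key {x : E} {y : F} (h : Good K (insert (x, y) s)) :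
        φ.Realize v (Fin.snoc xs x) ↔ φ.Realize w (Fin.snoc ys y) := by
      refine ih h (hfin.insert _) (fun i => .inr (hv i)) fun i => ?_
      induction i using Fin.lastCases with
      | last => simp
      | cast i => simpa using Or.inr (hxs i)
    constructor
    · intro H y
      obtain ⟨x, hx⟩ := hs.exists_insert_left hE hfin y
      exact (key hx).1 (H x)
    · intro H x
      obtain ⟨y, hy⟩ := hs.exists_insert hF hfin x
      exact (key hy).2 (H y)

end Realize

end Algebra

section

open Polynomial

variable {K A B : Type} [Field K] [CommRing A] [CommRing B] [Algebra K A] [Algebra K B]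

theorem mem_adjoin_iff_clo {s : Set A} {x : A} : x ∈ Algebra.adjoin K s ↔
    Clo (fun x => (∃ k, algebraMap K A k = x) ∨ x ∈ s) (fun y z x => y + z = x ∨ y * z = x) x := by
  constructor
  · intro h
    induction h using Algebra.adjoin_induction with
    | mem x hx => exact .base (.inr hx)
    | algebraMap k => exact .base (.inl ⟨k, rfl⟩)
    | add x y _ _ hx hy => exact .op hx hy (.inl rfl)
    | mul x y _ _ hx hy => exact .op hx hy (.inr rfl)
  · intro h
    induction h with
    | base h =>
      obtain ⟨k, rfl⟩ | h := h
      · exact Subalgebra.algebraMap_mem _ k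
      · exact Algebra.subset_adjoin h
    | op _ _ h h₁ h₂ =>
      obtain rfl | rfl := h
      · exact add_mem h₁ h₂
      · exact mul_mem h₁ h₂

theorem isAlgebraic_subalgebra_iff_clo {S : Subalgebra K A} {y : A} : IsAlgebraic S y ↔
    Clo (fun z => z ∈ S ∧ z ≠ 0) (fun u _ z => ∃ c, c ∈ S ∧ u * y + c = z) 0 := by
  have key (z : A) : Clo (fun z => z ∈ S ∧ z ≠ 0) (fun u _ z => ∃ c, c ∈ S ∧ u * y + c = z) z ↔
      ∃ P : S[X], P ≠ 0 ∧ aeval y P = z := by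
    constructor
    · intro h
      induction h with
      | @base z h =>
        refine ⟨C ⟨z, h.1⟩, fun h' => h.2 ?_, by simp⟩
        exact congrArg Subtype.val (C_eq_zero.1 h')
      | op _ _ h ih _ =>
        obtain ⟨c, hc, rfl⟩ := h
        obtain ⟨P, hP, rfl⟩ := ih
        refine ⟨P * X + C ⟨c, hc⟩, fun h => hP ?_, by simp⟩
        ext1 n
        simpa [coeff_C] using congrArg (coeff · (n + 1)) h
    · rintro ⟨P, hP, rfl⟩
      generalize hn : P.natDegree = n
      induction n using Nat.strong_induction_on generalizing P with
      | _ n ih =>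
        have hd := divX_mul_X_add P
        by_cases h : P.divX = 0
        · rw [h, zero_mul, zero_add] at hd
          rw [← hd, aeval_C]
          refine .base ⟨(P.coeff 0).2, fun h => hP ?_⟩
          rw [← hd, C_eq_zero]
          exact Subtype.ext h
        · have hlt : P.divX.natDegree < n := by
            rw [← hn]
            rw [natDegree_divX_eq_natDegree_tsub_one]
            have : P.natDegree ≠ 0 := by
              intro h0
              rw [eq_C_of_natDegree_eq_zero h0, divX_C] at h
              exact h rfl
            omega
          have := ih _ hlt P.divX h rfl
          refine .op this this ⟨_, (P.coeff 0).2, ?_⟩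
          conv_rhs => rw [← hd]
          simp
  rw [key]
  rfl

theorem isAlgebraic_adjoin_image_iff (g : A →ₐ[K] B) (hg : Function.Injective g) {s : Set A}
    {x : A} : IsAlgebraic (Algebra.adjoin K (g '' s)) (g x) ↔
      IsAlgebraic (Algebra.adjoin K s) x := by
  rw [← AlgHom.map_adjoin]
  exact isAlgebraic_ringHom_iff_of_comp_eq
    ((Algebra.adjoin K s).equivMapOfInjective g hg) g hg rfl

end

theorem exists_eq_of_isAlgebraic {K M N : Type} [Field K] [Field M] [Field N] [Algebra K M]
    [Algebra K N] [IsAlgClosed M] (g : M →ₐ[K] N) {s : Set M} {y : N}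
    (hy : IsAlgebraic (Algebra.adjoin K (g '' s)) y) : ∃ x, g x = y := by
  let := g.toRingHom.toAlgebra
  have hM : IsAlgebraic M y := by
    rw [← AlgHom.map_adjoin] at hy
    let e := (Algebra.adjoin K s).equivMapOfInjective g g.injective
    have he (z : (Algebra.adjoin K s).map g) : g (e.symm z) = z :=
      congrArg Subtype.val (e.apply_symm_apply z)
    refine hy.ringHom_of_comp_eq (S := M) (A := N) (B := N)
      (R := (Algebra.adjoin K s).map g)
      ((Algebra.adjoin K s).val.toRingHom.comp e.symm.toRingHom) (RingHom.id N)
      (Subtype.val_injective.comp e.symm.injective) (RingHom.ext he)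
  have h := IsAlgClosed.degree_eq_one_of_irreducible M (minpoly.irreducible hM.isIntegral)
  exact minpoly.mem_range_of_degree_eq_one M y h

/-! ## Arithmetical rings -/

/-- A ring whose elements and operations are arithmetical in `Y`. -/
class ArRing (Y : Set ℕ) (A : Type) [Coded A] [CommRing A] : Prop extends ArType Y A where
  arF_add' : ArF Y fun x : A × A => x.1 + x.2
  arF_mul' : ArF Y fun x : A × A => x.1 * x.2

theorem ArRing.trans {Y Z : Set ℕ} {A : Type} [Coded A] [CommRing A] [ArRing Z A]
    (h : ArReducible Z Y) : ArRing Y A where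
  toArType := .trans h
  arF_add' := ArF.trans ArRing.arF_add' h
  arF_mul' := ArF.trans ArRing.arF_mul' h

section

variable {Y : Set ℕ} {α A B : Type} [Coded α] [Coded A] [Coded B] [CommRing A] [CommRing B]
  [ArRing Y A] [ArRing Y B]

@[fun_prop]
theorem ArF.ringAdd {f g : α → A} (hf : ArF Y f) (hg : ArF Y g) : ArF Y fun a => f a + g a :=
  ArRing.arF_add'.comp (hf.prodMk hg)

@[fun_prop]
theorem ArF.ringMul {f g : α → A} (hf : ArF Y f) (hg : ArF Y g) : ArF Y fun a => f a * g a :=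
  ArRing.arF_mul'.comp (hf.prodMk hg)

instance : ArRing Y (A × B) where
  arF_add' := by
    change ArF Y fun x : (A × B) × (A × B) => (x.1.1 + x.2.1, x.1.2 + x.2.2)
    fun_prop
  arF_mul' := by
    change ArF Y fun x : (A × B) × (A × B) => (x.1.1 * x.2.1, x.1.2 * x.2.2)
    fun_prop

theorem arP_isAlgebraic_subalgebra [ArType Y α] {K : Type} [Field K] [Algebra K A]
    {S : α → Subalgebra K A} (hS : ArP Y fun x : α × A => x.2 ∈ S x.1) :
    ArP Y fun x : α × A => IsAlgebraic (S x.1) x.2 := by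
  have h : ArP Y fun x : (α × A) × A => Clo (fun z => z ∈ S x.1.1 ∧ z ≠ 0)
      (fun u _ z => ∃ c, c ∈ S x.1.1 ∧ u * x.1.2 + c = z) x.2 := by
    refine ArP.clo (base := fun (x : α × A) z => z ∈ S x.1 ∧ z ≠ 0)
      (op := fun (x : α × A) u _ z => ∃ c, c ∈ S x.1 ∧ u * x.2 + c = z)
      (.and (hS.comp (f := fun x : (α × A) × A => (x.1.1, x.2)) ?_) (.not (.eq ?_ ?_)))
      (.exists <| .and (hS.comp (f := fun x : ((α × A) × A × A × A) × A => (x.1.1.1, x.2)) ?_)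
        (.eq ?_ ?_)) <;> fun_prop
  refine (h.comp (f := fun x => (x, 0)) (.prodMk .id (.const 0))).congr fun x => ?_
  exact isAlgebraic_subalgebra_iff_clo.symm

variable {K : Type} [Coded K] [Field K] [ArType Y K] [Algebra K A] [Algebra K B]

theorem arP_mem_adjoin (hK : ArF Y (algebraMap K A)) :
    ArP Y fun x : List A × A => x.2 ∈ Algebra.adjoin K {z | z ∈ x.1} := by
  have : ArP Y fun x : List A × A => Clo (fun z => (∃ k, algebraMap K A k = z) ∨ z ∈ x.1)
      (fun y z x => y + z = x ∨ y * z = x) x.2 := by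
    refine ArP.clo (base := fun (l : List A) z => (∃ k, algebraMap K A k = z) ∨ z ∈ l)
      (op := fun _ y z x => y + z = x ∨ y * z = x)
      (.or (.exists <| .eq (hK.comp .snd) ?_) <| .mem ?_ ?_) (.or (.eq ?_ ?_) (.eq ?_ ?_)) <;>
      fun_prop
  exact this.congr fun x => mem_adjoin_iff_clo.symm

theorem arP_isAlgebraic (hK : ArF Y (algebraMap K A)) :
    ArP Y fun x : List A × A => IsAlgebraic (Algebra.adjoin K {z | z ∈ x.1}) x.2 :=
  arP_isAlgebraic_subalgebra (S := fun l : List A => Algebra.adjoin K {z | z ∈ l})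
    (arP_mem_adjoin hK)

end

section

variable {K E F : Type} [Field K] [Field E] [Field F] [Algebra K E] [Algebra K F]

theorem exists_algEquiv_of_good {s : Set (E × F)} (hs : Good K s) (h₁ : ∀ x, ∃ y, (x, y) ∈ s)
    (h₂ : ∀ y, ∃ x, (x, y) ∈ s) : ∃ f : E ≃ₐ[K] F, ∀ x y, (x, y) ∈ s ↔ f x = y := by
  choose f hf using h₁
  choose g hg using h₂
  have key {x : E} {y : F} (h : (x, y) ∈ Algebra.adjoin K s) : f x = y :=
    (hs.fst_eq_iff (Algebra.subset_adjoin (hf x)) h).1 rfl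
  have key' {x : E} {y : F} (h : (x, y) ∈ Algebra.adjoin K s) : g y = x :=
    (hs.fst_eq_iff (Algebra.subset_adjoin (hg y)) h).2 rfl
  have hf' (x : E) := Algebra.subset_adjoin (R := K) (hf x)
  refine ⟨⟨⟨f, g, fun x => key' (hf' x), fun y => key (Algebra.subset_adjoin (hg y))⟩,
    fun x y => key (mul_mem (hf' x) (hf' y)), fun x y => key (add_mem (hf' x) (hf' y)),
    fun k => key (Subalgebra.algebraMap_mem _ k)⟩, fun x y => ⟨fun h => ?_, ?_⟩⟩
  · exact key (Algebra.subset_adjoin h)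
  · rintro rfl
    exact hf x

theorem Good.iUnion {s : ℕ → Set (E × F)} (hmono : Monotone s) (hs : ∀ n, Good K (s n)) :
    Good K (⋃ n, s n) := by
  intro z hz
  obtain ⟨n, hn⟩ : ∃ n, z ∈ Algebra.adjoin K (s n) := by
    induction hz using Algebra.adjoin_induction with
    | mem x hx =>
      obtain ⟨n, hn⟩ := Set.mem_iUnion.1 hx
      exact ⟨n, Algebra.subset_adjoin hn⟩
    | algebraMap k => exact ⟨0, Subalgebra.algebraMap_mem _ k⟩
    | add x y _ _ hx hy =>
      obtain ⟨m, hm⟩ := hx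
      obtain ⟨n, hn⟩ := hy
      exact ⟨max m n, add_mem (Algebra.adjoin_mono (hmono (le_max_left m n)) hm)
        (Algebra.adjoin_mono (hmono (le_max_right m n)) hn)⟩
    | mul x y _ _ hx hy =>
      obtain ⟨m, hm⟩ := hx
      obtain ⟨n, hn⟩ := hy
      exact ⟨max m n, mul_mem (Algebra.adjoin_mono (hmono (le_max_left m n)) hm)
        (Algebra.adjoin_mono (hmono (le_max_right m n)) hn)⟩
  exact hs n z hn

theorem Good.exists_step [Coded E] [Coded F] [IsAlgClosed E] [IsAlgClosed F] (iE : InfTrdeg K E)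
    (iF : InfTrdeg K F) {l : List (E × F)} (hl : Good K {z | z ∈ l}) (n : ℕ) :
    ∃ l' : List (E × F), Good K {z | z ∈ l'} ∧ (∀ z, z ∈ l → z ∈ l') ∧
      (∀ x : E, code x = n → ∃ y, (x, y) ∈ l') ∧ ∀ y : F, code y = n → ∃ x, (x, y) ∈ l' := by
  obtain ⟨l₁, h₁, h₁', h₁''⟩ : ∃ l' : List (E × F), Good K {z | z ∈ l'} ∧
      (∀ z, z ∈ l → z ∈ l') ∧ ∀ x : E, code x = n → ∃ y, (x, y) ∈ l' := by
    by_cases h : ∃ x : E, code x = n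
    · obtain ⟨x, rfl⟩ := h
      obtain ⟨y, hy⟩ := hl.exists_insert iF l.finite_toSet x
      refine ⟨(x, y) :: l, hy.mono fun z => by simp,
        fun z hz => List.mem_cons_of_mem _ hz, fun x' hx => ⟨y, by simp [code_injective hx]⟩⟩
    · exact ⟨l, hl, fun _ => id, fun x hx => (h ⟨x, hx⟩).elim⟩
  by_cases h : ∃ y : F, code y = n
  · obtain ⟨y, rfl⟩ := h
    obtain ⟨x, hx⟩ := h₁.exists_insert_left iE l₁.finite_toSet y
    refine ⟨(x, y) :: l₁, hx.mono fun z => by simp, fun z hz => List.mem_cons_of_mem _ (h₁' z hz),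
      fun x' hx => ?_, fun y' hy => ?_⟩
    · obtain ⟨y', hy'⟩ := h₁'' x' hx
      exact ⟨y', List.mem_cons_of_mem _ hy'⟩
    · exact ⟨x, by simp [code_injective hy]⟩
  · exact ⟨l₁, h₁, h₁', h₁'', fun y hy => (h ⟨y, hy⟩).elim⟩

end

section

variable {Y : Set ℕ} {K E F : Type} [Field K] [Field E] [Field F] [Coded K] [Coded E] [Coded F]
  [ArType Y K] [ArRing Y E] [ArRing Y F] [Algebra K E] [Algebra K F]

theorem arP_good (hE : ArF Y (algebraMap K E)) (hF : ArF Y (algebraMap K F)) :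
    ArP Y fun l : List (E × F) => Good K {z | z ∈ l} := by
  refine .forall (p := fun (l : List (E × F)) z => z ∈ Algebra.adjoin K {z | z ∈ l} →
    (z.1 = 0 ↔ z.2 = 0)) <| .imp (arP_mem_adjoin ?_) <| .iff (.eq ?_ ?_) (.eq ?_ ?_)
  · exact hE.prodMk hF
  all_goals fun_prop

theorem exists_arF_algEquiv [IsAlgClosed E] [IsAlgClosed F] (iE : InfTrdeg K E)
    (iF : InfTrdeg K F) (hE : ArF Y (algebraMap K E)) (hF : ArF Y (algebraMap K F)) :
    ∃ f : E ≃ₐ[K] F, ArF Y f ∧ ArF Y f.symm := by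
  obtain ⟨step, hstep, hstep'⟩ := ArP.exists_choice (Y := Y) (α := ℕ × List (E × F))
    (β := List (E × F)) (P := fun a l' => Good K {z | z ∈ a.2} → Good K {z | z ∈ l'} ∧
      (∀ z, z ∈ a.2 → z ∈ l') ∧ (∀ x : E, code x = a.1 → ∃ y, (x, y) ∈ l') ∧
        ∀ y : F, code y = a.1 → ∃ x, (x, y) ∈ l') (by
      refine .imp ((arP_good hE hF).comp (f := fun x : (ℕ × List (E × F)) × List (E × F) =>
        x.1.2) ?_) <| .and ((arP_good hE hF).comp ?_) <| .and (.forall <| .imp (.mem ?_ ?_)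
        (.mem ?_ ?_)) <| .and (.forall <| .imp (.eq ?_ ?_) <| .exists <| .mem ?_ ?_)
        (.forall <| .imp (.eq ?_ ?_) <| .exists <| .mem ?_ ?_) <;> fun_prop) fun a => by
      by_cases h : Good K {z | z ∈ a.2}
      · obtain ⟨l', hl'⟩ := Good.exists_step iE iF h a.1
        exact ⟨l', fun _ => hl'⟩
      · exact ⟨[], fun h' => (h h').elim⟩
  let G : ℕ → List (E × F) := fun n =>
    Nat.rec (motive := fun _ => List (E × F)) [] (fun n l => step (n, l)) n
  have hG : ArF Y G := arF_iterate [] hstep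
  have hgood (n : ℕ) : Good K {z | z ∈ G n} := by
    induction n with
    | zero => exact good_empty.mono fun z hz => (List.not_mem_nil hz).elim
    | succ n ih => exact (hstep' (n, G n) ih).1
  have hmono : Monotone fun n => {z | z ∈ G n} :=
    monotone_nat_of_le_succ fun n => (hstep' (n, G n) (hgood n)).2.1
  obtain ⟨f, hf⟩ := exists_algEquiv_of_good (Good.iUnion hmono hgood)
    (fun x => by
      obtain ⟨y, hy⟩ := (hstep' (code x, G (code x)) (hgood _)).2.2.1 x rfl
      exact ⟨y, Set.mem_iUnion.2 ⟨code x + 1, hy⟩⟩)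
    (fun y => by
      obtain ⟨x, hx⟩ := (hstep' (code y, G (code y)) (hgood _)).2.2.2 y rfl
      exact ⟨x, Set.mem_iUnion.2 ⟨code y + 1, hx⟩⟩)
  have hR : ArP Y fun z : E × F => ∃ n, z ∈ G n := .exists <| .mem .fst (hG.comp .snd)
  have hR' (z : E × F) : (∃ n, z ∈ G n) ↔ f z.1 = z.2 := by
    rw [← hf, Set.mem_iUnion]
    rfl
  refine ⟨f, hR.congr hR', ?_⟩
  refine (hR.comp (f := fun z : F × E => (z.2, z.1)) (by fun_prop)).congr fun z => ?_
  rw [hR', AlgEquiv.symm_apply_eq, eq_comm]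

end

/-! ## Transfer of arithmetical complexity between a field and an extension -/

section

variable {Y : Set ℕ} {α β γ : Type} [Coded α] [Coded β] [Coded γ]

theorem ArReducible.refl (X : Set ℕ) : ArReducible X X :=
  arReducible_iff_isVarDef.2 (IsTermFun.var 0).mem

theorem arReducible_empty : ArReducible ∅ Y := by
  have : ArP Y fun n : ℕ => n < n ∧ n < n := .and (.lt .id .id) (.lt .id .id)
  exact ArP.arReducible (this.congr fun n => by simp)

theorem codeSet_eq_of_map {e : α → β} (he : ∀ a, code (e a) = code a) (p : α → Prop) :
    codeSet p = codeSet fun b => ∃ a, e a = b ∧ p a := by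
  ext n
  constructor
  · rintro ⟨a, rfl, ha⟩
    exact ⟨e a, he a, a, rfl, ha⟩
  · rintro ⟨_, rfl, a, rfl, ha⟩
    exact ⟨a, (he a).symm, ha⟩

theorem ArP.of_map {p : α → Prop} {q : β → Prop} (hq : ArP Y q) {e : α → β}
    (he : ∀ a, code (e a) = code a) (h : ∀ b, q b ↔ ∃ a, e a = b ∧ p a) : ArP Y p := by
  rw [ArP, codeSet_eq_of_map he, ← funext fun b => propext (h b)]
  exact hq

theorem code_map {e : α → β} (he : ∀ a, code (e a) = code a) {n : ℕ} (v : Fin n → α) :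
    code (e ∘ v) = code v :=
  congrArg tupleCode (funext fun i => he (v i))

end

section

variable {K M N : Type} [Field K] [Field M] [Field N] [Algebra K M] [Algebra K N]
  [Coded K] [Coded M] [Coded N] [ArType ∅ K] [ArRing ∅ N] [IsAlgClosed M]

theorem infTrdeg_of_not_arP (hK : ArF ∅ (algebraMap K N)) (ι : M →ₐ[K] N)
    (hι : ∀ x, code (ι x) = code x) (hM : ¬ ArP ∅ fun _ : M => True) : InfTrdeg K M := by
  intro t ht
  by_contra! h
  let l := ht.toFinset.toList.map ι
  have hl : {z | z ∈ l} = ι '' t := by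
    ext
    simp [l]
  have hp : ArP ∅ fun y : N => IsAlgebraic (Algebra.adjoin K {z | z ∈ l}) y :=
    (arP_isAlgebraic hK).comp (f := fun y => (l, y)) (.prodMk (.const l) .id)
  refine hM (hp.of_map hι fun y => ?_)
  rw [hl]
  constructor
  · intro hy
    obtain ⟨x, hx⟩ := exists_eq_of_isAlgebraic ι hy
    exact ⟨x, hx, trivial⟩
  · rintro ⟨x, rfl, -⟩
    refine (isAlgebraic_adjoin_image_iff ι ι.injective).2 ?_
    have := h x
    rwa [Transcendental, not_not] at this

theorem exists_transcendental_of_not_arP (hK : ArF ∅ (algebraMap K N)) (ι : M →ₐ[K] N)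
    (hι : ∀ x, code (ι x) = code x) {m n : ℕ} (b : Fin m → M) {X : Set (Fin n → M)}
    {P : (Fin n → N) → Prop} (hP : ArP ∅ P) (hPX : ∀ v, P (ι ∘ v) ↔ v ∈ X)
    (hX : ¬ ArP ∅ fun v => v ∈ X) :
    ∃ v ∈ X, ∃ i, Transcendental (Algebra.adjoin K (Set.range b)) (v i) := by
  by_contra! h
  let l := (List.ofFn b).map ι
  have hl : {z | z ∈ l} = ι '' Set.range b := by
    ext
    simp [l]
  have hp : ArP ∅ fun u : Fin n → N =>
      (∀ i, IsAlgebraic (Algebra.adjoin K {z | z ∈ l}) (u i)) ∧ P u :=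
    .and (.forall_fin fun i => (arP_isAlgebraic hK).comp (f := fun u : Fin n → N => (l, u i))
      (.prodMk (.const l) (arF_apply i))) hP
  refine hX (hp.of_map (e := fun v => ι ∘ v) (fun v => code_map hι v) fun u => ?_)
  rw [hl]
  constructor
  · rintro ⟨hu, hu'⟩
    choose v hv using fun i => exists_eq_of_isAlgebraic ι (hu i)
    obtain rfl : ι ∘ v = u := funext hv
    exact ⟨v, rfl, (hPX v).1 hu'⟩
  · rintro ⟨v, rfl, hv⟩
    refine ⟨fun i => (isAlgebraic_adjoin_image_iff ι ι.injective).2 ?_, (hPX v).2 hv⟩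
    have := h v hv i
    rwa [Transcendental, not_not] at this

end

section

variable {K E F : Type} [Field K] [Field E] [Field F] [Algebra K E] [Algebra K F]

theorem good_diagonal (t : Set E) : Good K ((fun x => (x, x)) '' t) := by
  intro z hz
  have : z.1 = z.2 := by
    induction hz using Algebra.adjoin_induction with
    | mem x hx =>
      obtain ⟨x, -, rfl⟩ := hx
      rfl
    | algebraMap k => rfl
    | add x y _ _ hx hy => exact congrArg₂ _ hx hy
    | mul x y _ _ hx hy => exact congrArg₂ _ hx hy
  rw [this]

theorem Good.exists_union_range [IsAlgClosed F] (hF : InfTrdeg K F) {s : Set (E × F)}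
    (hs : Good K s) (hfin : s.Finite) {n : ℕ} (v : Fin n → E) :
    ∃ w : Fin n → F, Good K (s ∪ Set.range fun i => (v i, w i)) := by
  induction n generalizing s with
  | zero => exact ⟨Fin.elim0, by simpa [Set.range_eq_empty] using hs⟩
  | succ n ih =>
    obtain ⟨y, hy⟩ := hs.exists_insert hF hfin (v 0)
    obtain ⟨w, hw⟩ := ih hy (hfin.insert _) (Fin.tail v)
    refine ⟨Fin.cons y w, hw.mono ?_⟩
    rintro z (hz | ⟨i, rfl⟩)
    · exact .inl (.inr hz)
    · cases i using Fin.cases with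
      | zero => exact .inl (.inl rfl)
      | succ i => exact .inr ⟨i, rfl⟩

/-- If a coordinate of a point of a definable set is transcendental over the parameters, then
every transcendental element is the same coordinate of a point of the set. -/
theorem exists_realize_of_transcendental [FirstOrder.Ring.CompatibleRing E] [IsAlgClosed E]
    (hE : InfTrdeg K E)
    {m n : ℕ} (ψ : Language.ring.Formula (Fin n ⊕ Fin m)) {b : Fin m → E} {v : Fin n → E}
    (hv : ψ.Realize (Sum.elim v b)) {i : Fin n}
    (hi : Transcendental (Algebra.adjoin K (Set.range b)) (v i)) {y : E}
    (hy : Transcendental (Algebra.adjoin K (Set.range b)) y) :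
    ∃ w : Fin n → E, ψ.Realize (Sum.elim w b) ∧ w i = y := by
  have hb := (good_diagonal (K := K) (Set.range b)).insert_of_transcendental (x := v i) (y := y)
    (by rwa [Set.image_image, Set.image_id']) (by rwa [Set.image_image, Set.image_id'])
  have hfin : (insert (v i, y) ((fun x => (x, x)) '' Set.range b)).Finite :=
    ((Set.finite_range b).image _).insert _
  obtain ⟨w, hw⟩ := hb.exists_union_range hE hfin v
  refine ⟨w, ?_, ?_⟩
  · refine (hw.realize_iff hE hE ψ (hfin.union (Set.finite_range _)) ?_ fun i => i.elim0).1 hv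
    rintro (j | j)
    · exact .inr ⟨j, rfl⟩
    · exact .inl (.inr ⟨b j, ⟨j, rfl⟩, rfl⟩)
  · have h₁ : (v i, y) ∈ Algebra.adjoin K (insert (v i, y) ((fun x => (x, x)) '' Set.range b) ∪
        Set.range fun i => (v i, w i)) := Algebra.subset_adjoin (.inl (.inl rfl))
    exact ((hw.fst_eq_iff (Algebra.subset_adjoin (.inr ⟨i, rfl⟩)) h₁).1 rfl)

end

section

variable {K M N M' N' : Type} [Field K] [Field M] [Field N] [Field M'] [Field N']
  [Algebra K M] [Algebra K N] [Algebra K M'] [Algebra K N'] [Coded K] [Coded M] [Coded N]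
  [Coded M'] [Coded N'] [ArType ∅ K] [ArRing ∅ N] [ArRing ∅ N'] [IsAlgClosed M]
  [IsAlgClosed M'] [FirstOrder.Ring.CompatibleRing M]

theorem arP_true_of_image (hK : ArF ∅ (algebraMap K N)) (hK' : ArF ∅ (algebraMap K N'))
    (ι : M →ₐ[K] N) (ι' : M' →ₐ[K] N') (hι : ∀ x, code (ι x) = code x)
    (hι' : ∀ x, code (ι' x) = code x) (f : M ≃ₐ[K] M') {m n : ℕ} {b : Fin m → M}
    (ψ : Language.ring.Formula (Fin n ⊕ Fin m))
    {P : (Fin n → N) → Prop} (hP : ArP ∅ P) (hPψ : ∀ v, P (ι ∘ v) ↔ ψ.Realize (Sum.elim v b))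
    (hM : InfTrdeg K M) (hψ : ¬ ArP ∅ fun v : Fin n → M => ψ.Realize (Sum.elim v b)) {W : Set ℕ}
    (hW : W = codeSet fun u => u ∈ (fun v => f ∘ v) '' {v | ψ.Realize (Sum.elim v b)}) :
    ArP W fun _ : M' => True := by
  obtain ⟨v, hv, i, hi⟩ := exists_transcendental_of_not_arP hK ι hι b hP hPψ hψ
  let l := (List.ofFn b).map (ι'.comp f.toAlgHom)
  have hl : {z | z ∈ l} = ι' '' (f '' Set.range b) := by
    ext
    simp [l]
  have := ArType.trans (γ := N') (arReducible_empty (Y := W))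
  have h₁ : ArP W fun z : N' => ∃ u : Fin n → N', code u ∈ W ∧ u i = z :=
    .exists <| .and ((ArReducible.refl W).arP_mem.comp (.comp .code .snd)) <|
      .eq (.comp (arF_apply i) .snd) .fst
  have h₂ : ArP ∅ fun z : N' => IsAlgebraic (Algebra.adjoin K {z | z ∈ l}) z :=
    (arP_isAlgebraic hK').comp (f := fun y => (l, y)) (.prodMk (.const l) .id)
  refine (h₁.or (h₂.trans arReducible_empty)).of_map hι' fun z => ?_
  rw [hl]
  constructor
  · rintro (⟨u, hu, rfl⟩ | hz)
    · rw [hW] at hu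
      obtain ⟨w, hw, -⟩ := hu
      rw [← code_map hι' w] at hw
      rw [← code_injective hw]
      exact ⟨w i, rfl, trivial⟩
    · obtain ⟨x, hx⟩ := exists_eq_of_isAlgebraic ι' hz
      exact ⟨x, hx, trivial⟩
  · rintro ⟨y, rfl, -⟩
    obtain ⟨x, rfl⟩ := f.surjective y
    refine or_iff_not_imp_right.2 fun hx => ?_
    rw [isAlgebraic_adjoin_image_iff ι' ι'.injective] at hx
    have hx' : Transcendental (Algebra.adjoin K (Set.range b)) x := fun h =>
      hx ((isAlgebraic_adjoin_image_iff f.toAlgHom f.injective).2 h)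
    obtain ⟨w, hw, rfl⟩ := exists_realize_of_transcendental hM ψ hv hi hx'
    refine ⟨ι' ∘ f ∘ w, ?_, rfl⟩
    rw [hW, code_map hι', code_mem_codeSet]
    exact ⟨w, hw, rfl⟩

end

/-! ## Gödel numbers of formulas -/

section

theorem termCode_injective (g : GoedelCoding L) {α : Type} {encα : α → ℕ}
    (h : Function.Injective encα) : Function.Injective (termCode g encα) := by
  refine (Encodable.encode_injective.comp (List.map_injective_iff.2 ?_)).comp
    Term.listEncode_injective
  rintro (a | ⟨n, f⟩) (b | ⟨m, k⟩) hab <;>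
    simp only [Sum.elim_inl, Sum.elim_inr, Nat.pair_eq_pair] at hab
  · rw [h hab.2]
  · exact absurd hab.1 zero_ne_one
  · exact absurd hab.1 one_ne_zero
  · obtain ⟨-, rfl, h'⟩ := hab
    rw [g.encFun_inj _ h']

theorem formulaCode_injective (g : GoedelCoding L) {α : Type} {encα : α → ℕ}
    (h : Function.Injective encα) {n : ℕ} :
    Function.Injective (formulaCode g encα : L.BoundedFormula α n → ℕ) := by
  have hterm (k : ℕ) : Function.Injective (termCode g
      (Sum.elim (fun a => Nat.pair 0 (encα a)) fun i : Fin k => Nat.pair 1 i.1)) := by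
    refine termCode_injective g ?_
    rintro (a | i) (b | j) hab <;>
      simp only [Sum.elim_inl, Sum.elim_inr, Nat.pair_eq_pair] at hab
    · rw [h hab.2]
    · exact absurd hab.1 zero_ne_one
    · exact absurd hab.1 one_ne_zero
    · rw [Fin.ext hab.2]
  intro φ ψ hφψ
  have := List.map_injective_iff.2 (fun x y hxy => ?_) (Encodable.encode_injective hφψ)
  · exact eq_of_heq (Sigma.mk.inj (BoundedFormula.listEncode_sigma_injective
      (a₁ := ⟨n, φ⟩) (a₂ := ⟨n, ψ⟩) this)).2
  · obtain (⟨k, t⟩ | ⟨k, r⟩ | k) := x <;> obtain (⟨l, u⟩ | ⟨l, s⟩ | l) := y <;>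
      simp only [Sum.elim_inl, Sum.elim_inr, Nat.pair_eq_pair] at hxy <;>
      try exact absurd hxy.1 (by decide)
    · obtain ⟨-, rfl, h'⟩ := hxy
      rw [hterm k h']
    · obtain ⟨-, rfl, h'⟩ := hxy
      rw [g.encRel_inj _ h']
    · rw [hxy.2]

/-! ## Decidable structures and elementary extensions -/

variable {A B : Set ℕ} {hA : (Aᶜ : Set ℕ).Infinite} {hB : (Bᶜ : Set ℕ).Infinite}
  [SA : L.Structure A] [SB : L.Structure B] {g : GoedelCoding L}

theorem ArithDecidable.arP_realize (h : ArithDecidable g ⟨A, hA, SA⟩) {k : ℕ}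
    (φ : L.Formula (Fin k)) : ArP ∅ fun a : Fin k → A => φ.Realize a := by
  have h' : ArP ∅ fun n : ℕ => Nat.pair (Nat.pair k (formulaCode g Fin.val φ)) n ∈
      elemDiagram g ⟨A, hA, SA⟩ := by
    refine (ArReducible.arP_mem h).comp (.pair (.const _) .id)
  have : codeSet (fun a : Fin k → A => φ.Realize a) = {n : ℕ |
      Nat.pair (Nat.pair k (formulaCode g Fin.val φ)) n ∈ elemDiagram g ⟨A, hA, SA⟩} := by
    ext n
    constructor
    · rintro ⟨a, rfl, ha⟩
      exact ⟨k, φ, a, rfl, ha⟩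
    · rintro ⟨k', φ', a, h, ha⟩
      simp only [Nat.pair_eq_pair] at h
      obtain ⟨⟨rfl, h⟩, rfl⟩ := h
      rw [← formulaCode_injective g Fin.val_injective h] at ha
      exact ⟨a, rfl, ha⟩
  rw [ArP, this]
  exact h'.arReducible

theorem ArithDecidable.arType (h : ArithDecidable g ⟨A, hA, SA⟩) : ArType ∅ A := by
  have h' : ArP ∅ fun n : ℕ => Nat.pair n 0 + 1 ∈
      codeSet fun a : Fin 1 → A => (⊤ : L.Formula (Fin 1)).Realize a :=
    (ArReducible.arP_mem (h.arP_realize ⊤)).comp (.add (.pair .id (.const 0)) (.const 1))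
  have : codeSet (fun _ : A => True) = {n | Nat.pair n 0 + 1 ∈
      codeSet fun a : Fin 1 → A => (⊤ : L.Formula (Fin 1)).Realize a} := by
    ext n
    constructor
    · rintro ⟨a, rfl, -⟩
      exact ⟨fun _ => a, rfl, by simp⟩
    · rintro ⟨a, ha, -⟩
      refine ⟨a 0, ?_, trivial⟩
      exact (Nat.pair_eq_pair.1 (Nat.succ_injective ha)).1
  refine ⟨?_⟩
  rw [ArP, this]
  exact h'.arReducible

theorem ElemSub.exists_elementaryEmbedding (h : ElemSub ⟨A, hA, SA⟩ ⟨B, hB, SB⟩) :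
    ∃ e : A ↪ₑ[L] B, ∀ x, (e x : ℕ) = x :=
  ⟨⟨fun x => ⟨x, h.subset x.2⟩, fun k φ a => (h.elem k φ a).symm⟩, fun _ => rfl⟩

end

section

variable {Y : Set ℕ} {α β A B : Type} [Coded α] [Coded β] [Coded A] [Coded B]

theorem ArF.of_code_eq [ArType Y α] [ArType Y β] {e : α → β}
    (he : ∀ a, Coded.code (e a) = Coded.code a) :
    ArF Y e := by
  refine .of_code ?_
  rw [funext he]
  exact .code

theorem ArRing.of_code_eq [CommRing A] [CommRing B] [ArType Y A] [ArRing Y B] (e : A →+* B)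
    (he : ∀ a, code (e a) = code a) : ArRing Y A := by
  have h : ArF Y e := .of_code_eq he
  have hinj : Function.Injective e := fun x y hxy => code_injective <| by
    rw [← he, hxy, he]
  constructor
  · have : ArP Y fun x : (A × A) × A => e x.1.1 + e x.1.2 = e x.2 := by
      refine .eq ?_ ?_ <;> fun_prop
    refine this.congr fun x => ?_
    rw [← map_add, hinj.eq_iff]
  · have : ArP Y fun x : (A × A) × A => e x.1.1 * e x.1.2 = e x.2 := by
      refine .eq ?_ ?_ <;> fun_prop
    refine this.congr fun x => ?_
    rw [← map_mul, hinj.eq_iff]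

end

/-! ## Algebraically closed fields as coded structures -/

section

open FirstOrder.Ring FirstOrder.Field

theorem exists_field_of_models (p : ℕ) {A : Set ℕ} {hA : (Aᶜ : Set ℕ).Infinite}
    {S : Language.ring.Structure A} (h : CodedStructure.Models ⟨A, hA, S⟩ (Theory.ACF p)) :
    ∃ (_ : Field A) (C : CompatibleRing A), C.toStructure = S ∧ IsAlgClosed A := by
  have : (Theory.ACF p).Model A := ⟨fun {φ} hφ => h φ hφ⟩
  have := modelField_of_modelACF p A
  let := fieldOfModelACF p A
  let := compatibleRingOfModelField A
  exact ⟨_, this, rfl, isAlgClosed_of_model_ACF p A⟩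

section

variable {A B : Type} [Field A] [Field B] [CompatibleRing A] [CompatibleRing B]

theorem exists_ringHom (e : A ↪ₑ[Language.ring] B) : ∃ f : A →+* B, ∀ x, f x = e x := by
  have hadd (x y : A) : e (x + y) = e x + e y := by
    simpa [CompatibleRing.funMap_add] using e.map_fun addFunc ![x, y]
  have hmul (x y : A) : e (x * y) = e x * e y := by
    simpa [CompatibleRing.funMap_mul] using e.map_fun mulFunc ![x, y]
  have hone : e 1 = 1 := by
    simpa [CompatibleRing.funMap_one] using e.map_fun oneFunc ![]
  have hzero : e 0 = 0 := by
    simpa [CompatibleRing.funMap_zero] using e.map_fun zeroFunc ![]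
  exact ⟨⟨⟨⟨e, hone⟩, hmul⟩, hzero, hadd⟩, fun _ => rfl⟩

end

section

variable {A B : Set ℕ} [Field A] [Field B] [CA : CompatibleRing A] [CB : CompatibleRing B]
  (hA : (Aᶜ : Set ℕ).Infinite) (hB : (Bᶜ : Set ℕ).Infinite)

/-- A ring isomorphism as an isomorphism of coded structures. -/
def codedIsoOfRingEquiv (f : A ≃+* B) :
    CodedIso ⟨A, hA, CA.toStructure⟩ ⟨B, hB, CB.toStructure⟩ where
  toFun := f
  invFun := f.symm
  left_inv := f.symm_apply_apply
  right_inv := f.apply_symm_apply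
  map_fun φ v := (languageEquivEquivRingEquiv.symm f).map_fun φ v
  map_rel r v := ((languageEquivEquivRingEquiv.symm f).map_rel r v).symm

variable {hA} in
theorem ArithDecidable.arRing {g : GoedelCoding Language.ring}
    (h : ArithDecidable g ⟨A, hA, CA.toStructure⟩) : ArRing ∅ A := by
  have := h.arType
  have key (φ : Language.ring.Formula (Fin 3)) :
      ArP ∅ fun x : (A × A) × A => φ.Realize ![x.1.1, x.1.2, x.2] := by
    refine (h.arP_realize φ).comp (.pi fun i => ?_)
    fin_cases i
    · change ArF ∅ fun x : (A × A) × A => x.1.1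
      fun_prop
    · change ArF ∅ fun x : (A × A) × A => x.1.2
      fun_prop
    · change ArF ∅ fun x : (A × A) × A => x.2
      fun_prop
  refine ⟨?_, ?_⟩
  · refine (key (Term.equal (Term.var 0 + Term.var 1) (Term.var 2))).congr fun x => ?_
    simp
  · refine (key (Term.equal (Term.var 0 * Term.var 1) (Term.var 2))).congr fun x => ?_
    simp

end

end

/-! ## Images of definable sets -/

section

variable {K M N M' N' : Type} [Field K] [Field M] [Field N] [Field M'] [Field N']
  [Algebra K M] [Algebra K N] [Algebra K M'] [Algebra K N'] [Coded K] [Coded M] [Coded N]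
  [Coded M'] [Coded N'] [ArType ∅ K] [ArRing ∅ N] [ArRing ∅ N'] [IsAlgClosed M]
  [IsAlgClosed M'] [Ring.CompatibleRing M]

theorem arEquiv_image {d : Set ℕ} [ArType d M] [ArType d M']
    (hK : ArF ∅ (algebraMap K N)) (hK' : ArF ∅ (algebraMap K N'))
    (ι : M →ₐ[K] N) (ι' : M' →ₐ[K] N') (hι : ∀ x, code (ι x) = code x)
    (hι' : ∀ x, code (ι' x) = code x) (hM : InfTrdeg K M) (hd : ¬ IsArithmetical d)
    (hM' : ArReducible d (codeSet fun _ : M' => True)) (f : M ≃ₐ[K] M') (hf : ArF d f) {m n : ℕ}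
    {b : Fin m → M} (ψ : Language.ring.Formula (Fin n ⊕ Fin m)) {P : (Fin n → N) → Prop}
    (hP : ArP ∅ P) (hPψ : ∀ v, P (ι ∘ v) ↔ ψ.Realize (Sum.elim v b)) {X : Set (Fin n → M)}
    (hX : X = {v | ψ.Realize (Sum.elim v b)}) (hXd : ArEquiv (codeSet fun v => v ∈ X) d) :
    ArEquiv (codeSet fun u => u ∈ (fun v => f ∘ v) '' X) d := by
  constructor
  · have hX' : ArP d fun v => v ∈ X := hXd.1
    refine (ArP.exists (Y := d) (p := fun (u : Fin n → M') v => v ∈ X ∧ f ∘ v = u)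
      (.and (hX'.comp .snd) (.eq (.pi fun i => ?_) .fst)) : ArP d _)
    exact hf.comp (.comp (arF_apply i) .snd)
  · subst hX
    refine hM'.trans ?_
    exact arP_true_of_image hK hK' ι ι' hι hι' f ψ hP hPψ hM (fun h => hd (hXd.2.trans h)) rfl

end

theorem tupleSetCode_eq_codeSet {A : Set ℕ} {n : ℕ} (X : Set (Fin n → A)) :
    tupleSetCode X = codeSet fun v => v ∈ X := by
  ext c
  constructor
  · rintro ⟨v, hv, rfl⟩
    exact ⟨v, rfl, hv⟩
  · rintro ⟨v, rfl, hv⟩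
    exact ⟨v, hv, rfl⟩

theorem ArF.arReducible_graphCode {Y A B : Set ℕ} {f : A → B} (hf : ArF Y f) :
    ArReducible (graphCode f) Y := by
  have : graphCode f = codeSet fun x : A × B => f x.1 = x.2 := by
    ext c
    constructor
    · rintro ⟨a, rfl⟩
      exact ⟨(a, f a), rfl, rfl⟩
    · rintro ⟨⟨a, b⟩, rfl, h⟩
      exact ⟨a, by rw [show f a = b from h]; rfl⟩
  rw [this]
  exact hf

theorem codeSet_true (A : Set ℕ) : codeSet (fun _ : A => True) = A := by
  ext c
  constructor
  · rintro ⟨a, rfl, -⟩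
    exact a.2
  · intro hc
    exact ⟨⟨c, hc⟩, rfl, trivial⟩

theorem ArithDecidable.arP_realize_elim {L : FirstOrder.Language} {A : Set ℕ}
    {hA : (Aᶜ : Set ℕ).Infinite} [SA : L.Structure A] {g : GoedelCoding L}
    (h : ArithDecidable g ⟨A, hA, SA⟩) {m n : ℕ} (ψ : L.Formula (Fin n ⊕ Fin m))
    (b : Fin m → A) : ArP ∅ fun v : Fin n → A => ψ.Realize (Sum.elim v b) := by
  have := h.arType
  refine ((h.arP_realize (ψ.relabel finSumFinEquiv)).comp
    (f := fun v : Fin n → A => Fin.append v b) (.pi fun i => ?_)).congr fun v => ?_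
  · cases i using Fin.addCases with
    | left i =>
      simp only [Fin.append_left]
      exact arF_apply i
    | right i =>
      simp only [Fin.append_right]
      exact .const _
  · rw [Formula.realize_relabel]
    congr! 1
    ext (i | i) <;> simp

theorem arEquiv_tupleSetCode_image {A₀ A A' B B' : Set ℕ} [Field A₀] [Field A] [Field A']
    [Field B] [Field B']
    [Algebra A₀ A] [Algebra A₀ A'] [Algebra A₀ B] [Algebra A₀ B'] [CA : Ring.CompatibleRing A]
    [CB : Ring.CompatibleRing B] [ArType ∅ A₀] [ArRing ∅ B'] [IsAlgClosed A] [IsAlgClosed A']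
    {hA : (Aᶜ : Set ℕ).Infinite} {hB : (Bᶜ : Set ℕ).Infinite} {d : Set ℕ}
    [ArType d A] [ArType d A'] {g : GoedelCoding Language.ring}
    (hdec : ArithDecidable g ⟨B, hB, CB.toStructure⟩)
    (hK : ArF ∅ (algebraMap A₀ B)) (hK' : ArF ∅ (algebraMap A₀ B'))
    (e : A ↪ₑ[Language.ring] B) (he : ∀ x, (e x : ℕ) = x)
    (ι : A →ₐ[A₀] B) (ι' : A' →ₐ[A₀] B') (hι : ∀ x, ι x = e x)
    (hι' : ∀ x, (ι' x : ℕ) = x) (hM : InfTrdeg A₀ A) (hd : ¬ IsArithmetical d)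
    (hA'd : ArReducible d A') (f : A ≃ₐ[A₀] A') (hf : ArF d f) {n : ℕ} {X : Set (Fin n → A)}
    (hX : DefinableIn ⟨A, hA, CA.toStructure⟩ X) (hXd : ArEquiv (tupleSetCode X) d) :
    ArEquiv (tupleSetCode ((fun v => f ∘ v) '' X)) d := by
  obtain ⟨m, ψ, b, -, hX⟩ := hX
  rw [tupleSetCode_eq_codeSet] at hXd ⊢
  rw [← codeSet_true A'] at hA'd
  have := hdec.arRing
  refine arEquiv_image hK hK' ι ι' (fun x => ?_) hι' hM hd hA'd f hf ψ
    (hdec.arP_realize_elim ψ (e ∘ b)) (fun v => ?_) hX hXd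
  · rw [hι]
    exact he x
  · rw [← e.map_formula, Sum.comp_elim, funext hι]

/-- **`ACF_p` is `D`-categorical** for every `p` equal to `0` or a prime and every nonzero
arithmetic degree `D`. -/
theorem acf_D_categorical
    (p : ℕ) (hp : p = 0 ∨ p.Prime)
    (g : GoedelCoding Language.ring) (hL : ArithLang g)
    (hT : ArithTheory g (Theory.ACF p))
    (d : Set ℕ) (hd : ¬ IsArithmetical d) :
    DCategorical g (Theory.ACF p) d := by
  rintro ⟨A₀, hA₀, S₀⟩ ⟨A₁, hA₁, S₁⟩ ⟨A₂, hA₂, S₂⟩ dec₀ mod₀ mod₁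
    ⟨⟨B₁, hB₁, T₁⟩, dec₁, mod₁', sub₁⟩ mod₂ ⟨⟨B₂, hB₂, T₂⟩, dec₂, mod₂', sub₂⟩ sub₀₁ sub₀₂ hd₁ hd₂
  obtain ⟨_, _, rfl, _⟩ := exists_field_of_models p mod₀
  obtain ⟨_, _, rfl, _⟩ := exists_field_of_models p mod₁
  obtain ⟨_, _, rfl, _⟩ := exists_field_of_models p mod₂
  obtain ⟨_, _, rfl, _⟩ := exists_field_of_models p mod₁'
  obtain ⟨_, _, rfl, _⟩ := exists_field_of_models p mod₂'
  have := dec₀.arType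
  have := dec₁.arRing
  have := dec₂.arRing
  have : ArRing d B₁ := .trans arReducible_empty
  have : ArRing d B₂ := .trans arReducible_empty
  have : ArType d A₀ := .trans arReducible_empty
  have : ArType d A₁ := ⟨by rw [ArP, codeSet_true]; exact hd₁.1⟩
  have : ArType d A₂ := ⟨by rw [ArP, codeSet_true]; exact hd₂.1⟩
  obtain ⟨e₁, he₁⟩ := sub₁.exists_elementaryEmbedding
  obtain ⟨e₂, he₂⟩ := sub₂.exists_elementaryEmbedding
  obtain ⟨e₀₁, he₀₁⟩ := sub₀₁.exists_elementaryEmbedding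
  obtain ⟨e₀₂, he₀₂⟩ := sub₀₂.exists_elementaryEmbedding
  obtain ⟨r₁, hr₁⟩ := exists_ringHom e₁
  obtain ⟨r₂, hr₂⟩ := exists_ringHom e₂
  obtain ⟨r₀₁, hr₀₁⟩ := exists_ringHom e₀₁
  obtain ⟨r₀₂, hr₀₂⟩ := exists_ringHom e₀₂
  let := r₀₁.toAlgebra
  let := r₀₂.toAlgebra
  let := (r₁.comp r₀₁).toAlgebra
  let := (r₂.comp r₀₂).toAlgebra
  let ι₁ : A₁ →ₐ[A₀] B₁ := ⟨r₁, fun _ => rfl⟩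
  let ι₂ : A₂ →ₐ[A₀] B₂ := ⟨r₂, fun _ => rfl⟩
  have hι₁ (x : A₁) : code (ι₁ x) = code x := (congrArg Subtype.val (hr₁ x)).trans (he₁ x)
  have hι₂ (x : A₂) : code (ι₂ x) = code x := (congrArg Subtype.val (hr₂ x)).trans (he₂ x)
  have h₀₁ (x : A₀) : code (algebraMap A₀ A₁ x) = code x :=
    (congrArg Subtype.val (hr₀₁ x)).trans (he₀₁ x)
  have h₀₂ (x : A₀) : code (algebraMap A₀ A₂ x) = code x :=
    (congrArg Subtype.val (hr₀₂ x)).trans (he₀₂ x)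
  have hK₁ : ArF ∅ (algebraMap A₀ B₁) := .of_code_eq fun x => (hι₁ _).trans (h₀₁ x)
  have hK₂ : ArF ∅ (algebraMap A₀ B₂) := .of_code_eq fun x => (hι₂ _).trans (h₀₂ x)
  have : ArRing d A₁ := .of_code_eq r₁ hι₁
  have : ArRing d A₂ := .of_code_eq r₂ hι₂
  have i₁ : InfTrdeg A₀ A₁ := infTrdeg_of_not_arP hK₁ ι₁ hι₁ fun h => hd <| hd₁.2.trans <| by
    rwa [ArP, codeSet_true] at h
  have i₂ : InfTrdeg A₀ A₂ := infTrdeg_of_not_arP hK₂ ι₂ hι₂ fun h => hd <| hd₂.2.trans <| by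
    rwa [ArP, codeSet_true] at h
  obtain ⟨f, hf, hf'⟩ := exists_arF_algEquiv (Y := d) i₁ i₂ (.of_code_eq h₀₁) (.of_code_eq h₀₂)
  refine ⟨codedIsoOfRingEquiv hA₁ hA₂ f.toRingEquiv, ⟨hf.arReducible_graphCode,
    hf'.arReducible_graphCode, fun n X hX hXd => ?_, fun n X hX hXd => ?_⟩, fun x hx hx' => ?_⟩
  · exact arEquiv_tupleSetCode_image dec₁ hK₁ hK₂ e₁ he₁ ι₁ ι₂ hr₁ hι₂ i₁ hd hd₂.2 f hf hX hXd
  · exact arEquiv_tupleSetCode_image dec₂ hK₂ hK₁ e₂ he₂ ι₂ ι₁ hr₂ hι₁ i₂ hd hd₁.2 f.symm hf' hX hXd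
  · have h₁ : algebraMap A₀ A₁ ⟨x, hx⟩ = ⟨x, hx'⟩ := Subtype.ext (h₀₁ ⟨x, hx⟩)
    have h₂ := f.commutes ⟨x, hx⟩
    rw [h₁] at h₂
    exact (congrArg Subtype.val h₂).trans (h₀₂ ⟨x, hx⟩)

end ArMorley
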